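/- arXiv:1511.01731 — 17 statements merged into one kernel-verified Lean document; each statement's English description precedes it below -/
import Mathlib

section
/- The ∣_L-maximal classes in βℕ are exactly the minimal left ideals of βℕ, there are 2^𝔠 of them (where 𝔠 is the cardinality of the continuum), and every element lies below a ∣_L-maximal element. Precisely: call p ∈ βℕ ∣_L-maximal if for every q, p ∣_L q implies q ∣_L p. Then (i) p is ∣_L-maximal if and only if the principal left ideal βℕ·p = {x·p : x ∈ βℕ} is a minimal left ideal (a nonempty set L closed under left multiplication by arbitrary elements of βℕ that contains no nonempty proper subset with the same closure property); (ii) if p is ∣_L-maximal then its class {q : p ∣_L q and q ∣_L p} equals βℕ·p; (iii) the set of minimal left ideals of βℕ has cardinality 2^(2^ℵ₀); (iv) for every q ∈ βℕ there exists a ∣_L-maximal p with q ∣_L p. -/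
attribute [local instance] Ultrafilter.semigroup

namespace Stmt0

abbrev βN := Ultrafilter ℕ+

/-- `p ∣_L q` iff there is `r` with `q = r * p`. -/
def DivL (p q : βN) : Prop := ∃ r : βN, q = r * p

/-- A left ideal of `βℕ`: nonempty and closed under left multiplication. -/
def IsLeftIdeal (L : Set βN) : Prop := L.Nonempty ∧ ∀ p ∈ L, ∀ x : βN, x * p ∈ L

/-- A minimal left ideal: a left ideal containing no nonempty proper subset which
is itself a left ideal. -/
def IsMinimalLeftIdeal (L : Set βN) : Prop :=
  IsLeftIdeal L ∧ ∀ L' ⊆ L, IsLeftIdeal L' → L' = L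

/-- `p` is `∣_L`-maximal. -/
def MaximalL (p : βN) : Prop := ∀ q : βN, DivL p q → DivL q p

open Filter

/-- A countable independent family: the traces on a sequence of all subsets of `ℕ` are prescribable
on any finite collection of subsets, arbitrarily far along the sequence. -/
theorem exists_seq_finite_agreement :
    ∃ d : ℕ → Set (Set ℕ), ∀ (f : Set (Set ℕ)) (I : Finset (Set ℕ)) (N : ℕ),
      ∃ n, N ≤ n ∧ ∀ X ∈ I, X ∈ d n ↔ X ∈ f := by
  classical
  obtain ⟨e, he⟩ := exists_surjective_nat (Finset ℕ × Finset (Finset ℕ))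
  refine ⟨fun n => {X | (e n.unpair.1).1.filter (· ∈ X) ∈ (e n.unpair.1).2}, fun f I N => ?_⟩
  have hsep : ∀ P : Set ℕ × Set ℕ, ∃ k, P.1 ≠ P.2 → ¬ (k ∈ P.1 ↔ k ∈ P.2) := by
    intro P
    by_cases h : P.1 = P.2
    · exact ⟨0, fun h' => (h' h).elim⟩
    · obtain ⟨k, hk⟩ := not_forall.1 fun h' => h (Set.ext h')
      exact ⟨k, fun _ => hk⟩
  choose k hk using hsep
  let F : Finset ℕ := (I ×ˢ I).image k
  obtain ⟨m, hm⟩ := he (F, (I.filter (· ∈ f)).image fun X => F.filter (· ∈ X))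
  refine ⟨Nat.pair m N, Nat.right_le_pair _ _, fun X hX => ?_⟩
  simp only [Nat.unpair_pair, hm, Set.mem_ofPred_eq, Finset.mem_image, Finset.mem_filter]
  refine ⟨?_, fun h => ⟨X, ⟨hX, h⟩, rfl⟩⟩
  rintro ⟨Y, ⟨hY, hYf⟩, hXY⟩
  suffices Y = X from this ▸ hYf
  by_contra hne
  refine hk (Y, X) hne ?_
  have hF : k (Y, X) ∈ F := Finset.mem_image_of_mem _ (Finset.mk_mem_product hY hX)
  have := Finset.ext_iff.1 hXY (k (Y, X))
  simpa [hF] using this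

/-- There are at least `2 ^ 2 ^ ℵ₀` nonprincipal ultrafilters on `ℕ`. -/
theorem exists_injective_ultrafilter_le_atTop :
    ∃ U : Set (Set ℕ) → Ultrafilter ℕ, Function.Injective U ∧ ∀ f, (U f : Filter ℕ) ≤ atTop := by
  obtain ⟨d, hd⟩ := exists_seq_finite_agreement
  choose n hn hnd using hd
  let G (f : Set (Set ℕ)) : Filter ℕ :=
    map (fun x : Finset (Set ℕ) × ℕ => n f x.1 x.2) (atTop ×ˢ atTop)
  have hG (f) (X : Set ℕ) : ∀ᶠ i in Ultrafilter.of (G f), X ∈ d i ↔ X ∈ f := by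
    refine Ultrafilter.of_le (G f) (eventually_map.2 ?_)
    filter_upwards [(eventually_ge_atTop ({X} : Finset (Set ℕ))).prod_inl _] with x hx
    exact hnd f _ _ X (hx (Finset.mem_singleton_self X))
  refine ⟨fun f => Ultrafilter.of (G f), fun f g hfg => ?_, fun f => ?_⟩
  · ext X
    have h := hG f X
    rw [show Ultrafilter.of (G f) = Ultrafilter.of (G g) from hfg] at h
    obtain ⟨i, hi, hi'⟩ := (h.and (hG g X)).exists
    exact hi.symm.trans hi'
  · refine (Ultrafilter.of_le (G f)).trans ?_
    exact tendsto_atTop_mono (fun x => hn f x.1 x.2) tendsto_snd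

theorem mul_lt_factorial {k l n : ℕ} (hkl : k < l) (hn : n ≤ k) :
    n * k.factorial < l.factorial :=
  calc n * k.factorial ≤ k * k.factorial := Nat.mul_le_mul_right _ hn
    _ < (k + 1) * k.factorial := Nat.mul_lt_mul_of_pos_right k.lt_succ_self k.factorial_pos
    _ = (k + 1).factorial := (Nat.factorial_succ k).symm
    _ ≤ l.factorial := Nat.factorial_le hkl

theorem eq_of_mul_factorial_eq {k l n m : ℕ} (hn : n ≤ k) (hm : m ≤ l) (hn0 : 0 < n) (hm0 : 0 < m)
    (h : n * k.factorial = m * l.factorial) : k = l := by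
  rcases lt_trichotomy k l with hkl | hkl | hkl
  · exact absurd h ((mul_lt_factorial hkl hn).trans_le (Nat.le_mul_of_pos_left _ hm0)).ne
  · exact hkl
  · exact absurd h ((mul_lt_factorial hkl hm).trans_le (Nat.le_mul_of_pos_left _ hn0)).ne'

/-- The image of an ultrafilter on `ℕ` under the factorial. -/
def factorialMap (U : Ultrafilter ℕ) : βN := U.map fun k => ⟨k.factorial, k.factorial_pos⟩

theorem eventually_mul_factorialMap {U : Ultrafilter ℕ} (hU : (U : Filter ℕ) ≤ atTop) (r : βN)
    {A : Set ℕ} (hA : A ∈ U) :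
    ∀ᶠ x : ℕ+ in (r * factorialMap U : βN), ∃ k ∈ A, ∃ n : ℕ, 0 < n ∧ n ≤ k ∧
      (x : ℕ) = n * k.factorial := by
  rw [Ultrafilter.eventually_mul]
  refine Eventually.of_forall fun n => ?_
  change ∀ᶠ k in (U : Filter ℕ), _
  filter_upwards [hA, hU (eventually_ge_atTop (n : ℕ))] with k hk hnk
  exact ⟨k, hk, n, n.pos, hnk, rfl⟩

theorem eq_of_mul_factorialMap_eq {U V : Ultrafilter ℕ} (hU : (U : Filter ℕ) ≤ atTop)
    (hV : (V : Filter ℕ) ≤ atTop) {r s : βN} (h : r * factorialMap U = s * factorialMap V) :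
    U = V := by
  refine (Ultrafilter.eq_of_le fun A hA => ?_).symm
  by_contra hAV
  have h₁ := eventually_mul_factorialMap hU r hA
  have h₂ := eventually_mul_factorialMap hV s (Ultrafilter.compl_mem_iff_notMem.2 hAV)
  rw [h] at h₁
  obtain ⟨x, ⟨k, hk, n, hn, hnk, hx⟩, l, hl, m, hm, hml, hx'⟩ := (h₁.and h₂).exists
  exact hl (eq_of_mul_factorial_eq hnk hml hn hm (hx.symm.trans hx') ▸ hk)

theorem pure_one_mul (p : βN) : (pure 1 : βN) * p = p := by
  refine Ultrafilter.coe_inj.1 (Filter.ext' fun P => ?_)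
  rw [Ultrafilter.eventually_mul]
  simp

theorem DivL.refl (p : βN) : DivL p p := ⟨pure 1, (pure_one_mul p).symm⟩

theorem DivL.trans {p q r : βN} : DivL p q → DivL q r → DivL p r := by
  rintro ⟨a, rfl⟩ ⟨b, rfl⟩
  exact ⟨b * a, (mul_assoc _ _ _).symm⟩

theorem isCompact_setOf_divL (p : βN) : IsCompact {x | DivL p x} := by
  convert isCompact_range (Ultrafilter.continuous_mul_left p) using 1
  ext x
  exact exists_congr fun r => eq_comm

theorem exists_maximalL : ∃ p, MaximalL p := by
  refine exists_maximal_of_chains_bounded (fun c hc => ?_) DivL.trans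
  rcases c.eq_empty_or_nonempty with rfl | hne
  · exact ⟨pure 1, by simp⟩
  have : Nonempty c := hne.to_subtype
  have hdir : Directed (· ⊇ ·) fun p : c => {x | DivL p x} := by
    intro p q
    rcases eq_or_ne p.1 q.1 with h | h
    · exact ⟨p, fun _ => id, Subtype.ext h ▸ fun _ => id⟩
    · rcases hc p.2 q.2 h with h | h
      · exact ⟨q, fun x hx => h.trans hx, fun _ => id⟩
      · exact ⟨p, fun _ => id, fun x hx => h.trans hx⟩
  obtain ⟨x, hx⟩ := IsCompact.nonempty_iInter_of_directed_nonempty_isCompact_isClosed _ hdir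
    (fun p => ⟨p, DivL.refl p.1⟩) (fun p => isCompact_setOf_divL p)
    (fun p => (isCompact_setOf_divL p).isClosed)
  exact ⟨x, fun p hp => Set.mem_iInter.1 hx ⟨p, hp⟩⟩

theorem exists_maximalL_divL (q : βN) : ∃ p, MaximalL p ∧ DivL q p := by
  obtain ⟨m, hm⟩ := exists_maximalL
  refine ⟨m * q, ?_, m, rfl⟩
  rintro _ ⟨r, rfl⟩
  obtain ⟨s, hs⟩ := hm (r * m) ⟨r, rfl⟩
  exact ⟨s, by rw [← mul_assoc r, ← mul_assoc s, ← hs]⟩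

theorem isLeftIdeal_setOf_divL (p : βN) : IsLeftIdeal {x | DivL p x} :=
  ⟨⟨p, DivL.refl p⟩, fun _ hq x => DivL.trans hq ⟨x, rfl⟩⟩

theorem maximalL_iff (p : βN) : MaximalL p ↔ IsMinimalLeftIdeal {x | DivL p x} := by
  refine ⟨fun hp => ⟨isLeftIdeal_setOf_divL p, fun L hL hLI => hL.antisymm ?_⟩, fun hp q hq => ?_⟩
  · obtain ⟨q, hq⟩ := hLI.1
    obtain ⟨s, hs⟩ := hp q (hL hq)
    rintro _ ⟨r, rfl⟩
    exact hLI.2 _ (hs ▸ hLI.2 q hq s) r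
  · have h := hp.2 {x | DivL q x} (fun x hx => DivL.trans hq hx) (isLeftIdeal_setOf_divL q)
    exact h.ge (DivL.refl p)

theorem IsMinimalLeftIdeal.eq_setOf_divL {L : Set βN} (hL : IsMinimalLeftIdeal L) {p : βN}
    (hp : p ∈ L) : {x | DivL p x} = L := by
  refine hL.2 _ ?_ (isLeftIdeal_setOf_divL p)
  rintro _ ⟨r, rfl⟩
  exact hL.1.2 p hp r

theorem mk_minimalLeftIdeal_le :
    Cardinal.mk {L : Set βN // IsMinimalLeftIdeal L} ≤ Cardinal.mk (Set (Set ℕ+)) := by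
  have hsets : Function.Injective fun p : βN => (p : Filter ℕ+).sets :=
    fun p q h => Ultrafilter.coe_inj.1 (Filter.filter_eq h)
  have hpick : Function.Injective fun L : {L : Set βN // IsMinimalLeftIdeal L} =>
      L.2.1.1.choose := by
    intro L M h
    refine Subtype.ext ?_
    rw [← L.2.eq_setOf_divL L.2.1.1.choose_spec, ← M.2.eq_setOf_divL M.2.1.1.choose_spec]
    exact congrArg (fun p => {x | DivL p x}) h
  exact Cardinal.mk_le_of_injective (hsets.comp hpick)

theorem le_mk_minimalLeftIdeal :
    Cardinal.mk (Set (Set ℕ)) ≤ Cardinal.mk {L : Set βN // IsMinimalLeftIdeal L} := by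
  obtain ⟨U, hU, hle⟩ := exists_injective_ultrafilter_le_atTop
  choose m hm hdiv using fun f => exists_maximalL_divL (factorialMap (U f))
  refine Cardinal.mk_le_of_injective
    (f := fun f => ⟨{x | DivL (m f) x}, (maximalL_iff (m f)).1 (hm f)⟩) fun f g hfg => ?_
  have h : {x | DivL (m f) x} = {x | DivL (m g) x} := congrArg Subtype.val hfg
  obtain ⟨r, hr⟩ := (hdiv f).trans (h.ge (DivL.refl (m g)))
  obtain ⟨s, hs⟩ := hdiv g
  exact hU (eq_of_mul_factorialMap_eq (hle f) (hle g) (hr.symm.trans hs))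

theorem divL_maximal_classes :
    (∀ p : βN, MaximalL p ↔ IsMinimalLeftIdeal {x : βN | ∃ r : βN, x = r * p}) ∧
    (∀ p : βN, MaximalL p →
      {q : βN | DivL p q ∧ DivL q p} = {x : βN | ∃ r : βN, x = r * p}) ∧
    Cardinal.mk {L : Set βN // IsMinimalLeftIdeal L} = (2 : Cardinal) ^ ((2 : Cardinal) ^ Cardinal.aleph0) ∧
    (∀ q : βN, ∃ p : βN, MaximalL p ∧ DivL q p) := by
  refine ⟨maximalL_iff, fun p hp => ?_, le_antisymm ?_ ?_, exists_maximalL_divL⟩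
  · exact Set.ext fun q => ⟨And.left, fun h => ⟨h, hp q h⟩⟩
  · simpa using mk_minimalLeftIdeal_le
  · simpa using le_mk_minimalLeftIdeal

end Stmt0
end

section
/- The ∣_R-maximal classes in βℕ are exactly the minimal right ideals of βℕ, there are 2^𝔠 of them, and every element lies below a ∣_R-maximal element. Precisely: call p ∈ βℕ ∣_R-maximal if for every q, p ∣_R q implies q ∣_R p. Then (i) p is ∣_R-maximal if and only if the principal right ideal p·βℕ = {p·x : x ∈ βℕ} is a minimal right ideal (a nonempty set R closed under right multiplication by arbitrary elements of βℕ that contains no nonempty proper subset with the same closure property); (ii) if p is ∣_R-maximal then its class {q : p ∣_R q and q ∣_R p} equals p·βℕ; (iii) the set of minimal right ideals of βℕ has cardinality 2^(2^ℵ₀); (iv) for every q ∈ βℕ there exists a ∣_R-maximal p with q ∣_R p. -/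
attribute [local instance] Ultrafilter.semigroup

namespace Stmt1

abbrev βN := Ultrafilter ℕ+

/-- `p ∣_L q` iff there is `r` with `q = r * p`. -/
def DivL (p q : βN) : Prop := ∃ r : βN, q = r * p

/-- `p ∣_R q` iff there is `r` with `q = p * r`. -/
def DivR (p q : βN) : Prop := ∃ r : βN, q = p * r

/-- A right ideal of `βℕ`: nonempty and closed under right multiplication. -/
def IsRightIdeal (R : Set βN) : Prop := R.Nonempty ∧ ∀ p ∈ R, ∀ x : βN, p * x ∈ R

/-- A minimal right ideal. -/
def IsMinimalRightIdeal (R : Set βN) : Prop :=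
  IsRightIdeal R ∧ ∀ R' ⊆ R, IsRightIdeal R' → R' = R

/-- `p` is `∣_R`-maximal. -/
def MaximalR (p : βN) : Prop := ∀ q : βN, DivR p q → DivR q p

section CompactSemigroup

variable {M : Type*} [Semigroup M] [TopologicalSpace M] [CompactSpace M] [T2Space M] [Nonempty M]

/-- A compact right topological semigroup has a closed minimal left ideal. -/
theorem exists_isClosed_minimal_left_ideal (hcont : ∀ r : M, Continuous (· * r)) :
    ∃ L : Set M, IsClosed L ∧ L.Nonempty ∧ (∀ x, ∀ l ∈ L, x * l ∈ L) ∧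
      ∀ l ∈ L, ∀ m ∈ L, ∃ x ∈ L, x * l = m := by
  let S : Set (Set M) := {L | IsClosed L ∧ L.Nonempty ∧ ∀ x, ∀ l ∈ L, x * l ∈ L}
  obtain ⟨L, hL⟩ : ∃ L, Minimal (· ∈ S) L := by
    refine zorn_superset _ fun c hcs hc => ?_
    refine ⟨⋂₀ c, ⟨isClosed_sInter fun t ht => (hcs ht).1, ?_, fun x l hl => ?_⟩,
      fun s hs => Set.sInter_subset_of_mem hs⟩
    · obtain rfl | hne := c.eq_empty_or_nonempty
      · rw [Set.sInter_empty]
        exact Set.univ_nonempty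
      · have := hne.to_subtype
        have hdir : DirectedOn (· ⊇ ·) c := IsChain.directedOn hc.symm
        exact IsCompact.nonempty_sInter_of_directed_nonempty_isCompact_isClosed
          hdir (fun t ht => (hcs ht).2.1)
          (fun t ht => (hcs ht).1.isCompact) (fun t ht => (hcs ht).1)
    · exact Set.mem_sInter.mpr fun t ht => (hcs ht).2.2 x l (Set.mem_sInter.mp hl t ht)
  obtain ⟨hclosed, hne, hmul⟩ := hL.prop
  refine ⟨L, hclosed, hne, hmul, fun l hl m hm => ?_⟩
  have himage : (· * l) '' L = L := by
    apply hL.eq_of_subset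
    · refine ⟨(hcont l).isClosedMap _ hclosed, hne.image _, ?_⟩
      rintro x _ ⟨y, hy, rfl⟩
      exact ⟨x * y, hmul x y hy, mul_assoc x y l⟩
    · rintro _ ⟨y, -, rfl⟩
      exact hmul y l hl
  rwa [← himage] at hm

/-- In a compact right topological semigroup, every principal right ideal contains an idempotent
generating a minimal right ideal. -/
theorem exists_minimal_idempotent_mem_right_ideal (hcont : ∀ r : M, Continuous (· * r)) (q : M) :
    ∃ f : M, f * f = f ∧ (∃ r, f = q * r) ∧ ∀ b, ∃ c, f * b * c = f := by
  obtain ⟨L, hclosed, ⟨l, hl⟩, hmul, htrans⟩ := exists_isClosed_minimal_left_ideal hcont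
  have hql : q * l ∈ L := hmul q l hl
  obtain ⟨f, ⟨hfL, hfq⟩, hff⟩ := exists_idempotent_in_compact_subsemigroup hcont
    (L ∩ {x | x * (q * l) = q * l}) (htrans _ hql _ hql)
    (hclosed.inter (isClosed_singleton.preimage (hcont (q * l)))).isCompact (by
      rintro x ⟨-, hx : x * (q * l) = q * l⟩ y ⟨hy, hy' : y * (q * l) = q * l⟩
      refine ⟨hmul x y hy, ?_⟩
      change x * y * (q * l) = q * l
      rw [mul_assoc, hy', hx])
  replace hfq : f * (q * l) = q * l := hfq
  have hmin : ∀ b, ∃ c, f * b * c = f := by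
    intro b
    obtain ⟨c, hc, hcf⟩ := htrans (f * b * f) (hmul _ _ hfL) f hfL
    obtain ⟨d, -, hdf⟩ := htrans (f * c) (hmul f c hc) f hfL
    have hd : d * f = f * b * f := by
      calc d * f = d * (f * (c * (f * b * f))) := by rw [hcf, hff]
        _ = d * (f * c) * (f * b * f) := by simp only [mul_assoc]
        _ = f * f * b * f := by rw [hdf]; simp only [mul_assoc]
        _ = f * b * f := by rw [hff]
    refine ⟨f * c, ?_⟩
    calc f * b * (f * c) = f * b * f * c := by simp only [mul_assoc]
      _ = d * (f * c) := by rw [← hd, mul_assoc]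
      _ = f := hdf
  refine ⟨f, hff, ?_, hmin⟩
  obtain ⟨c, hc⟩ := hmin (q * l)
  exact ⟨l * c, by rw [← mul_assoc, ← hfq, hc]⟩

end CompactSemigroup

section ManyUltrafilters

open Filter

/-- A code for the trace of a finite family of sets on the interval `[0, N)`. -/
noncomputable def traceCode (N : ℕ) (T : Finset (Finset ℕ)) : ℕ := Nat.pair N (Encodable.encode T)

open scoped Classical in
/-- The trace of the set `A` on `[0, N)`. -/
noncomputable def initialTrace (N : ℕ) (A : Set ℕ) : Finset ℕ := {n ∈ Finset.range N | n ∈ A}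

theorem exists_initialTrace_injOn (F : Finset (Set ℕ)) :
    ∃ N, F.card ≤ N ∧ Set.InjOn (initialTrace N) (F : Set (Set ℕ)) := by
  have hsep : ∀ᶠ N in atTop, ∀ A ∈ F, ∀ B ∈ F, initialTrace N A = initialTrace N B → A = B := by
    refine (eventually_all_finset F).2 fun A _ => (eventually_all_finset F).2 fun B _ => ?_
    by_cases hAB : A = B
    · exact Eventually.of_forall fun _ _ => hAB
    · obtain ⟨n, hn⟩ : ∃ n, ¬(n ∈ A ↔ n ∈ B) := by
        by_contra! h
        exact hAB (Set.ext h)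
      filter_upwards [eventually_gt_atTop n] with N hN h
      have := Finset.ext_iff.1 h n
      simp [initialTrace, hN] at this
      exact absurd this hn
  obtain ⟨N, hN, hcard⟩ := (hsep.and (eventually_ge_atTop F.card)).exists
  exact ⟨N, hcard, fun A hA B hB h => hN A hA B hB h⟩

/-- Pospíšil's theorem: there are `2 ^ 𝔠` nonprincipal ultrafilters on `ℕ`. -/
theorem exists_injective_ultrafilter_tendsto_atTop :
    ∃ U : Set (Set ℕ) → Ultrafilter ℕ, Function.Injective U ∧ ∀ s, (U s : Filter ℕ) ≤ atTop := by
  classical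
  choose N hcard hinj using exists_initialTrace_injOn
  let g (s : Set (Set ℕ)) (F : Finset (Set ℕ)) : ℕ :=
    traceCode (N F) ((F.filter (· ∈ s)).image (initialTrace (N F)))
  let X (A : Set ℕ) : Set ℕ := {n | ∃ N T, n = traceCode N T ∧ initialTrace N A ∈ T}
  have hX : ∀ s A, ∀ᶠ F in atTop, (g s F ∈ X A ↔ A ∈ s) := by
    intro s A
    filter_upwards [eventually_ge_atTop {A}] with F hF
    have hAF : A ∈ F := hF (Finset.mem_singleton_self A)
    constructor
    · rintro ⟨K, T, hg, hT⟩
      obtain ⟨rfl, hT'⟩ := Nat.pair_eq_pair.1 hg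
      rw [← Encodable.encode_injective hT'] at hT
      obtain ⟨B, hB, hBA⟩ := Finset.mem_image.1 hT
      obtain ⟨hBF, hBs⟩ := Finset.mem_filter.1 hB
      rwa [← hinj F hBF hAF hBA]
    · intro hA
      exact ⟨_, _, rfl, Finset.mem_image_of_mem _ (Finset.mem_filter.2 ⟨hAF, hA⟩)⟩
  let U (s : Set (Set ℕ)) : Ultrafilter ℕ := Ultrafilter.of (map (g s) atTop)
  have hU : ∀ s, (U s : Filter ℕ) ≤ map (g s) atTop := fun s => Ultrafilter.of_le _
  have hmem : ∀ s A, ∀ᶠ n in U s, (n ∈ X A ↔ A ∈ s) := fun s A =>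
    hU s (eventually_map.2 (hX s A))
  refine ⟨U, fun s t hst => Set.ext fun A => ?_, fun s => (hU s).trans ?_⟩
  · have hs := hmem s A
    rw [hst] at hs
    obtain ⟨n, hn, hn'⟩ := (hs.and (hmem t A)).exists
    exact hn.symm.trans hn'
  · refine tendsto_atTop.2 fun k => ?_
    obtain ⟨F₀, hF₀⟩ := Infinite.exists_subset_card_eq (Set ℕ) k
    filter_upwards [eventually_ge_atTop F₀] with F hF
    calc k ≤ F.card := hF₀ ▸ Finset.card_le_card hF
      _ ≤ N F := hcard F
      _ ≤ g s F := Nat.left_le_pair _ _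

end ManyUltrafilters

section MinimalRightIdeals

open Filter

/-- The exponent of `2` in `n`. -/
def val2 (n : ℕ+) : ℕ := padicValNat 2 n

theorem val2_mul (m n : ℕ+) : val2 (m * n) = val2 m + val2 n := by
  simp [val2, padicValNat.mul]

theorem val2_two_pow (k : ℕ) : val2 (2 ^ k) = k := by
  simp [val2]

theorem padicValNat_two_pow_add (a m : ℕ) (h : 2 ^ (a + 1) ∣ m) :
    padicValNat 2 (2 ^ a + m) = a := by
  obtain ⟨t, rfl⟩ := h
  have hfac : 2 ^ a + 2 ^ (a + 1) * t = 2 ^ a * (2 * t + 1) := by ring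
  have hodd : padicValNat 2 (2 * t + 1) = 0 := padicValNat.eq_zero_of_not_dvd (by omega)
  rw [hfac, padicValNat.mul (by positivity) (by positivity), padicValNat.prime_pow, hodd, add_zero]

theorem eventually_dvd_val2_of_idempotent {e : βN} (he : e * e = e) (k : ℕ) :
    ∀ᶠ n in e, 2 ^ k ∣ val2 n := by
  obtain ⟨c, hc⟩ := Ultrafilter.eq_pure_of_finite (e.map fun n => (val2 n : ZMod (2 ^ k)))
  have hev : ∀ᶠ n in e, (val2 n : ZMod (2 ^ k)) = c := by
    have : {c} ∈ e.map fun n => (val2 n : ZMod (2 ^ k)) := by rw [hc]; exact Set.mem_singleton c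
    exact this
  have hev2 := hev
  rw [← he, Ultrafilter.eventually_mul] at hev2
  obtain ⟨n, hn, hn'⟩ := (hev.and hev2).exists
  obtain ⟨m, hm, hm'⟩ := (hev.and hn').exists
  rw [val2_mul, Nat.cast_add, hn, hm, add_eq_left] at hm'
  filter_upwards [hev] with n hn
  rw [hm'] at hn
  exact_mod_cast (ZMod.natCast_eq_zero_iff _ _).1 hn

/-- The image of `u` under `a ↦ 2 ^ 2 ^ a`. -/
def doubleExp (u : Ultrafilter ℕ) : βN := u.map fun a => 2 ^ 2 ^ a

/-- An idempotent multiple of `doubleExp u` determines `u`. -/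
theorem map_val2_val2_of_idempotent {u : Ultrafilter ℕ} (hu : (u : Filter ℕ) ≤ atTop) {e x : βN}
    (he : e * e = e) (hx : e = doubleExp u * x) :
    e.map (fun n => padicValNat 2 (val2 n)) = u := by
  have hdvd : ∀ k, ∀ᶠ m in x, 2 ^ k ∣ val2 m := by
    intro k
    have h := eventually_dvd_val2_of_idempotent he k
    rw [hx, Ultrafilter.eventually_mul] at h
    have h' : ∀ᶠ a in u, ∀ᶠ m in x, 2 ^ k ∣ val2 (2 ^ 2 ^ a * m) := h
    obtain ⟨a, ha, hka⟩ := (h'.and (hu (eventually_ge_atTop k))).exists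
    filter_upwards [ha] with m hm
    rw [val2_mul, val2_two_pow] at hm
    exact (Nat.dvd_add_right (pow_dvd_pow 2 hka)).1 hm
  refine (Ultrafilter.eq_of_le fun s hs => ?_).symm
  by_contra hsu
  have hsc : ∀ᶠ a in u, a ∉ s := Ultrafilter.compl_mem_iff_notMem.2 hsu
  have hs' : ∀ᶠ n in e, padicValNat 2 (val2 n) ∈ s := hs
  rw [hx, Ultrafilter.eventually_mul] at hs'
  have hs'' : ∀ᶠ a in u, ∀ᶠ m in x, padicValNat 2 (val2 (2 ^ 2 ^ a * m)) ∈ s := hs'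
  obtain ⟨a, ha, has⟩ := (hs''.and hsc).exists
  obtain ⟨m, hm, hdm⟩ := (ha.and (hdvd (a + 1))).exists
  rw [val2_mul, val2_two_pow, padicValNat_two_pow_add _ _ hdm] at hm
  exact has hm

theorem mul_pure_one (p : βN) : p * pure 1 = p := by
  refine Ultrafilter.coe_injective (Filter.ext' fun P => ?_)
  rw [Ultrafilter.eventually_mul]
  simp

theorem DivR.refl (p : βN) : DivR p p := ⟨pure 1, (mul_pure_one p).symm⟩

theorem DivR.trans {p q r : βN} : DivR p q → DivR q r → DivR p r := by
  rintro ⟨x, rfl⟩ ⟨y, rfl⟩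
  exact ⟨x * y, mul_assoc p x y⟩

theorem isRightIdeal_setOf_divR (p : βN) : IsRightIdeal {x | DivR p x} :=
  ⟨⟨p, DivR.refl p⟩, fun _ hq x => DivR.trans hq ⟨x, rfl⟩⟩

theorem IsMinimalRightIdeal.eq_setOf_divR {R : Set βN} (hR : IsMinimalRightIdeal R) {p : βN}
    (hp : p ∈ R) : R = {x | DivR p x} := by
  refine (hR.2 _ ?_ (isRightIdeal_setOf_divR p)).symm
  rintro _ ⟨x, rfl⟩
  exact hR.1.2 p hp x

theorem maximalR_iff_isMinimalRightIdeal (p : βN) :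
    MaximalR p ↔ IsMinimalRightIdeal {x | DivR p x} := by
  constructor
  · refine fun hp => ⟨isRightIdeal_setOf_divR p, fun R hRp hR => hRp.antisymm fun x hx => ?_⟩
    obtain ⟨q, hq⟩ := hR.1
    obtain ⟨y, rfl⟩ := (hp q (hRp hq)).trans hx
    exact hR.2 q hq y
  · intro hp q hq
    have h : p ∈ {x | DivR p x} := DivR.refl p
    rwa [hp.eq_setOf_divR hq] at h

theorem exists_idempotent_maximalR (q : βN) : ∃ f : βN, f * f = f ∧ DivR q f ∧ MaximalR f := by
  obtain ⟨f, hff, hqf, hf⟩ :=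
    exists_minimal_idempotent_mem_right_ideal Ultrafilter.continuous_mul_left q
  refine ⟨f, hff, hqf, ?_⟩
  rintro _ ⟨b, rfl⟩
  obtain ⟨c, hc⟩ := hf b
  exact ⟨c, hc.symm⟩

theorem mk_set_set_of_denumerable (α : Type) [Denumerable α] :
    Cardinal.mk (Set (Set α)) = (2 : Cardinal) ^ ((2 : Cardinal) ^ Cardinal.aleph0) := by
  rw [Cardinal.mk_set, Cardinal.mk_set, Cardinal.mk_denumerable]

theorem mk_isMinimalRightIdeal :
    Cardinal.mk {R : Set βN // IsMinimalRightIdeal R} =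
      (2 : Cardinal) ^ ((2 : Cardinal) ^ Cardinal.aleph0) := by
  apply le_antisymm
  · choose g hg using fun R : {R : Set βN // IsMinimalRightIdeal R} => R.2.1.1
    have hg_inj : Function.Injective fun R => {A : Set ℕ+ | A ∈ g R} := by
      intro R S hRS
      have hRS' : g R = g S := Ultrafilter.ext fun A => Set.ext_iff.1 hRS A
      apply Subtype.ext
      rw [R.2.eq_setOf_divR (hg R), S.2.eq_setOf_divR (hg S), hRS']
    rw [← mk_set_set_of_denumerable ℕ+]
    exact Cardinal.mk_le_of_injective hg_inj
  · obtain ⟨U, hU_inj, hU⟩ := exists_injective_ultrafilter_tendsto_atTop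
    choose f hff hUf hf using fun s => exists_idempotent_maximalR (doubleExp (U s))
    rw [← mk_set_set_of_denumerable ℕ]
    refine Cardinal.mk_le_of_injective
      (f := fun s => (⟨_, (maximalR_iff_isMinimalRightIdeal (f s)).1 (hf s)⟩ :
        {R : Set βN // IsMinimalRightIdeal R})) fun s t hst => hU_inj ?_
    have hts : DivR (f t) (f s) := by
      have h : f s ∈ {x | DivR (f s) x} := DivR.refl (f s)
      rwa [Subtype.mk.inj hst] at h
    obtain ⟨x, hx⟩ := hUf s
    obtain ⟨y, hy⟩ := (hUf t).trans hts
    rw [← map_val2_val2_of_idempotent (hU s) (hff s) hx,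
      ← map_val2_val2_of_idempotent (hU t) (hff s) hy]

end MinimalRightIdeals

theorem divR_maximal_classes :
    (∀ p : βN, MaximalR p ↔ IsMinimalRightIdeal {x : βN | ∃ r : βN, x = p * r}) ∧
    (∀ p : βN, MaximalR p →
      {q : βN | DivR p q ∧ DivR q p} = {x : βN | ∃ r : βN, x = p * r}) ∧
    Cardinal.mk {R : Set βN // IsMinimalRightIdeal R} = (2 : Cardinal) ^ ((2 : Cardinal) ^ Cardinal.aleph0) ∧
    (∀ q : βN, ∃ p : βN, MaximalR p ∧ DivR q p) := by
  refine ⟨maximalR_iff_isMinimalRightIdeal, fun p hp => ?_, mk_isMinimalRightIdeal, fun q => ?_⟩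
  · exact Set.ext fun q => ⟨fun hq => hq.1, fun hq => ⟨hq, hp q hq⟩⟩
  · obtain ⟨p, -, hqp, hp⟩ := exists_idempotent_maximalR q
    exact ⟨p, hp, hqp⟩

end Stmt1
end

section
/- For every q ∈ βℕ there exists a ∣_LN-maximal element p with q ∣_LN p; that is, there exists p such that q ∣_LN p and for every r, if p ∣_LN r then r ∣_LN p. -/
attribute [local instance] Ultrafilter.semigroup

namespace Stmt2

abbrev βN := Ultrafilter ℕ+

/-- `p ∣_L q` iff there is `r` with `q = r * p`. -/
def DivL (p q : βN) : Prop := ∃ r : βN, q = r * p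

/-- `p ∣_LN q` iff `p ∣_L n·q` for some `n ∈ ℕ+`. -/
def DivLN (p q : βN) : Prop := ∃ n : ℕ+, DivL p ((pure n : βN) * q)

theorem pure_one_mul (p : βN) : (pure 1 : βN) * p = p :=
  Ultrafilter.coe_inj.mp <| Filter.ext' fun P => by
    rw [Ultrafilter.eventually_mul]
    simp

theorem DivL.refl (p : βN) : DivL p p := ⟨pure 1, (pure_one_mul p).symm⟩

theorem DivL.trans {p q r : βN} : DivL p q → DivL q r → DivL p r := by
  rintro ⟨s, rfl⟩ ⟨t, rfl⟩
  exact ⟨t * s, (mul_assoc t s p).symm⟩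

theorem isClosed_setOf_divL (p : βN) : IsClosed {q | DivL p q} := by
  have h : {q | DivL p q} = Set.range fun r : βN => r * p := by
    ext q
    simp [DivL, eq_comm]
  rw [h]
  exact (isCompact_range (Ultrafilter.continuous_mul_left p)).isClosed

/-- A nonempty chain for left divisibility has an upper bound. -/
theorem exists_divL_upper_bound {c : Set βN} (hc : IsChain DivL c) (hne : c.Nonempty) :
    ∃ u, ∀ a ∈ c, DivL a u := by
  have : Nonempty c := hne.to_subtype
  obtain ⟨u, hu⟩ := IsCompact.nonempty_iInter_of_directed_nonempty_isCompact_isClosed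
    (fun a : c => {x : βN | DivL a x})
    (fun a b => by
      by_cases hab : (a : βN) = b
      · exact ⟨a, subset_rfl, fun x hx => by simpa [← hab] using hx⟩
      · rcases hc a.2 b.2 hab with h | h
        · exact ⟨b, fun x hx => h.trans hx, subset_rfl⟩
        · exact ⟨a, subset_rfl, fun x hx => h.trans hx⟩)
    (fun a => ⟨a, DivL.refl _⟩)
    (fun a => (isClosed_setOf_divL a).isCompact)
    (fun a => isClosed_setOf_divL a)
  exact ⟨u, fun a ha => Set.mem_iInter.mp hu ⟨a, ha⟩⟩

/-- Every ultrafilter left-divides one that generates a minimal left ideal. -/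
theorem exists_divL_maximal_above (q : βN) :
    ∃ p, DivL q p ∧ ∀ r, DivL p r → DivL r p := by
  obtain ⟨⟨p, hqp⟩, hp⟩ := exists_maximal_of_chains_bounded
    (r := fun a b : {x // DivL q x} => DivL a b)
    (fun c hc => by
      rcases c.eq_empty_or_nonempty with rfl | ⟨a, ha⟩
      · exact ⟨⟨q, DivL.refl q⟩, by simp⟩
      · obtain ⟨u, hu⟩ := exists_divL_upper_bound (c := Subtype.val '' c)
          (by
            rintro _ ⟨x, hx, rfl⟩ _ ⟨y, hy, rfl⟩ hxy
            exact hc hx hy fun h => hxy (congrArg _ h))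
          ⟨a, a, ha, rfl⟩
        exact ⟨⟨u, a.2.trans (hu a ⟨a, ha, rfl⟩)⟩, fun b hb => hu b ⟨b, hb, rfl⟩⟩)
    (fun hab hbc => hab.trans hbc)
  exact ⟨p, hqp, fun r hr => hp ⟨r, hqp.trans hr⟩ hr⟩

theorem DivL.divLN {p q : βN} (h : DivL p q) : DivLN p q :=
  ⟨1, by rwa [pure_one_mul]⟩

theorem exists_divLN_maximal_above :
    ∀ q : βN, ∃ p : βN, DivLN q p ∧ ∀ r : βN, DivLN p r → DivLN r p := by
  intro q
  obtain ⟨p, hqp, hp⟩ := exists_divL_maximal_above q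
  refine ⟨p, hqp.divLN, ?_⟩
  rintro r ⟨n, hn⟩
  exact (DivL.trans ⟨pure n, rfl⟩ (hp _ hn)).divLN

end Stmt2
end

section
/- Let K be the intersection of all nonempty two-sided ideals of βℕ (a set I ⊆ βℕ is a two-sided ideal if for every p ∈ I and every x ∈ βℕ, both x·p ∈ I and p·x ∈ I). Then K is nonempty, K is a single =_M-equivalence class (for all p, q ∈ K, p ∣_M q and q ∣_M p), this class is the greatest element of the order ∣_M on classes (for every p ∈ βℕ and every q ∈ K, p ∣_M q), and no element outside K lies ∣_M-above K (for every p, if q ∣_M p for some q ∈ K, then p ∈ K). -/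
attribute [local instance] Ultrafilter.semigroup

namespace Stmt3

abbrev βN := Ultrafilter ℕ+

/-- `p ∣_L q` iff there is `r` with `q = r * p`. -/
def DivL (p q : βN) : Prop := ∃ r : βN, q = r * p

/-- `p ∣_M q` iff there are `r, s` with `q = r * p * s`. -/
def DivM (p q : βN) : Prop := ∃ r s : βN, q = r * p * s

/-- A two-sided ideal of `βℕ`. -/
def IsIdeal (I : Set βN) : Prop :=
  ∀ p ∈ I, ∀ x : βN, x * p ∈ I ∧ p * x ∈ I

/-- `K(βℕ)`: the intersection of all nonempty two-sided ideals. -/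
def K : Set βN := ⋂₀ {I : Set βN | I.Nonempty ∧ IsIdeal I}

/-- A nonempty compact Hausdorff semigroup with continuous right multiplications has a minimal left
ideal `L`, generated by each of its elements. -/
theorem exists_nonempty_forall_range_mul_right_eq {S : Type*} [Semigroup S] [TopologicalSpace S]
    [CompactSpace S] [T2Space S] [Nonempty S] (hc : ∀ r : S, Continuous (· * r)) :
    ∃ L : Set S, L.Nonempty ∧ ∀ p ∈ L, Set.range (· * p) = L := by
  let A : Set (Set S) := {L | IsClosed L ∧ L.Nonempty ∧ ∀ p ∈ L, ∀ x, x * p ∈ L}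
  obtain ⟨L, hL⟩ : ∃ L, Minimal (· ∈ A) L := by
    refine zorn_superset _ fun c hcA hchain => ?_
    refine ⟨⋂₀ c, ⟨isClosed_sInter fun t ht => (hcA ht).1, ?_, ?_⟩,
      fun s hs => Set.sInter_subset_of_mem hs⟩
    · obtain rfl | hne := c.eq_empty_or_nonempty
      · simp
      · have := hne.to_subtype
        exact IsCompact.nonempty_sInter_of_directed_nonempty_isCompact_isClosed
          (IsChain.directedOn hchain.symm) (fun t ht => (hcA ht).2.1)
          (fun t ht => (hcA ht).1.isCompact) (fun t ht => (hcA ht).1)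
    · exact fun p hp x t ht => (hcA ht).2.2 p (hp t ht) x
  refine ⟨L, hL.prop.2.1, fun p hp => ?_⟩
  have hsub : Set.range (· * p) ⊆ L := by
    rintro _ ⟨x, rfl⟩
    exact hL.prop.2.2 p hp x
  refine hsub.antisymm (hL.le_of_le ⟨(isCompact_range (hc p)).isClosed, Set.range_nonempty _, ?_⟩
    hsub)
  rintro _ ⟨y, rfl⟩ x
  exact ⟨x * y, mul_assoc x y p⟩

theorem isIdeal_K : IsIdeal K := fun p hp x =>
  ⟨fun I hI => (hI.2 p (hp I hI) x).1, fun I hI => (hI.2 p (hp I hI) x).2⟩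

theorem K_nonempty : K.Nonempty := by
  obtain ⟨L, ⟨p, hp⟩, hL⟩ :=
    exists_nonempty_forall_range_mul_right_eq (S := βN) Ultrafilter.continuous_mul_left
  refine ⟨p, fun I ⟨⟨a, ha⟩, hI⟩ => ?_⟩
  have hap : a * p ∈ L := hL p hp ▸ Set.mem_range_self a
  obtain ⟨x, hx⟩ : p ∈ Set.range (· * (a * p)) := (hL _ hap).symm ▸ hp
  exact hx ▸ (hI _ (hI a ha p).2 x).1

theorem isIdeal_setOf_divM (p : βN) : IsIdeal {q | DivM p q} := by
  rintro _ ⟨r, s, rfl⟩ x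
  exact ⟨⟨x * r, s, by simp only [mul_assoc]⟩, ⟨r, s * x, by simp only [mul_assoc]⟩⟩

theorem divM_of_mem_K (p : βN) {q : βN} (hq : q ∈ K) : DivM p q :=
  hq {q | DivM p q} ⟨⟨p * p * p, p, p, rfl⟩, isIdeal_setOf_divM p⟩

theorem K_is_greatest_divM_class :
    K.Nonempty ∧
    (∀ p ∈ K, ∀ q ∈ K, DivM p q ∧ DivM q p) ∧
    (∀ p : βN, ∀ q ∈ K, DivM p q) ∧
    (∀ p : βN, (∃ q ∈ K, DivM q p) → p ∈ K) := by
  refine ⟨K_nonempty, fun p hp q hq => ⟨divM_of_mem_K p hq, divM_of_mem_K q hp⟩,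
    fun p q hq => divM_of_mem_K p hq, ?_⟩
  rintro _ ⟨q, hq, r, s, rfl⟩
  exact (isIdeal_K _ (isIdeal_K q hq r).1 s).2

end Stmt3
end

section
/- Let G = {q ∈ βℕ : every nonempty subset A ⊆ ℕ+ that is upward closed under divisibility (a ∈ A and a ∣ b imply b ∈ A) belongs to q}. Then: (i) G is nonempty; (ii) G is the greatest class of the order ∣~, i.e. for every p ∈ βℕ and every q ∈ G, p ∣~ q; (iii) G is upward closed and is a single =_~-class: if q ∈ G and q ∣~ r then r ∈ G; (iv) G contains the intersection K of all nonempty two-sided ideals of βℕ. -/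
attribute [local instance] Ultrafilter.semigroup

namespace Stmt4

abbrev βN := Ultrafilter ℕ+

/-- `p ∣_L q` iff there is `r` with `q = r * p`. -/
def DivL (p q : βN) : Prop := ∃ r : βN, q = r * p

/-- `p ∣~ q`. -/
def DivT (p q : βN) : Prop := ∀ A ∈ p, {m : ℕ+ | ∃ a ∈ A, a ∣ m} ∈ q

/-- A two-sided ideal of `βℕ`. -/
def IsIdeal (I : Set βN) : Prop :=
  ∀ p ∈ I, ∀ x : βN, x * p ∈ I ∧ p * x ∈ I

/-- `K(βℕ)`: the intersection of all nonempty two-sided ideals. -/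
def K : Set βN := ⋂₀ {I : Set βN | I.Nonempty ∧ IsIdeal I}

/-- The set of ultrafilters containing every nonempty upward (divisibility-)closed set. -/
def G : Set βN :=
  {q : βN | ∀ A : Set ℕ+, A.Nonempty → (∀ a ∈ A, ∀ b : ℕ+, a ∣ b → b ∈ A) → A ∈ q}

theorem G_nonempty : G.Nonempty := by
  refine ⟨Ultrafilter.map (fun n : ℕ => n.factorial.toPNat n.factorial_pos)
    (Filter.hyperfilter ℕ), ?_⟩
  rintro A ⟨a, ha⟩ hA
  have hev : ∀ᶠ n in (Filter.hyperfilter ℕ : Filter ℕ), (a : ℕ) ≤ n :=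
    Nat.hyperfilter_le_atTop (Filter.eventually_ge_atTop (a : ℕ))
  rw [Ultrafilter.mem_map]
  filter_upwards [hev] with n hn
  exact hA a ha _ (PNat.dvd_iff.mpr (Nat.dvd_factorial a.pos hn))

theorem divT_of_mem_G (p : βN) {q : βN} (hq : q ∈ G) : DivT p q := by
  intro A hA
  obtain ⟨a, ha⟩ := p.nonempty_of_mem hA
  exact hq _ ⟨a, a, ha, dvd_rfl⟩ fun _ ⟨c, hc, hcb⟩ _ h => ⟨c, hc, hcb.trans h⟩

theorem mem_G_of_divT {q r : βN} (hq : q ∈ G) (h : DivT q r) : r ∈ G := by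
  intro A hne hA
  refine Filter.mem_of_superset (h A (hq A hne hA)) ?_
  rintro m ⟨a, ha, ham⟩
  exact hA a ha m ham

theorem isIdeal_G : IsIdeal G := by
  refine fun p hp x => ⟨fun A hne hA => ?_, fun A hne hA => ?_⟩
  · refine (Ultrafilter.eventually_mul x p (· ∈ A)).mpr (Filter.Eventually.of_forall fun n => ?_)
    filter_upwards [hp A hne hA] with m hm
    exact hA m hm _ (dvd_mul_left m n)
  · refine (Ultrafilter.eventually_mul p x (· ∈ A)).mpr ?_
    filter_upwards [hp A hne hA] with n hn
    exact Filter.Eventually.of_forall fun m => hA n hn _ (dvd_mul_right n m)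

theorem G_is_greatest_divT_class :
    G.Nonempty ∧
    (∀ p : βN, ∀ q ∈ G, DivT p q) ∧
    (∀ q ∈ G, ∀ r : βN, DivT q r → r ∈ G) ∧
    K ⊆ G := by
  exact ⟨G_nonempty, fun p _ hq => divT_of_mem_G p hq, fun _ hq _ h => mem_G_of_divT hq h,
    Set.sInter_subset_of_mem ⟨G_nonempty, isIdeal_G⟩⟩

end Stmt4
end

section
/- There is a family of 𝔠 pairwise ∣~-incompatible elements of βℕ: there exists a set F ⊆ βℕ of cardinality continuum such that for all distinct p, q ∈ F there is no r ∈ βℕ with r ≠ pure 1, r ∣~ p and r ∣~ q. -/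
attribute [local instance] Ultrafilter.semigroup

namespace Stmt5

abbrev βN := Ultrafilter ℕ+

/-- `p ∣_L q` iff there is `r` with `q = r * p`. -/
def DivL (p q : βN) : Prop := ∃ r : βN, q = r * p

/-- `p ∣~ q`. -/
def DivT (p q : βN) : Prop := ∀ A ∈ p, {m : ℕ+ | ∃ a ∈ A, a ∣ m} ∈ q

theorem DivT.eq_of_prime {r p : βN} (hp : {n : ℕ+ | n.Prime} ∈ p) (hr : r ≠ pure 1)
    (h : DivT r p) : r = p := by
  have hne : ({1}ᶜ : Set ℕ+) ∈ r := by
    refine Ultrafilter.compl_mem_iff_notMem.2 fun h1 => hr (Ultrafilter.eq_of_le ?_)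
    exact Filter.le_pure_iff.2 h1
  refine (Ultrafilter.eq_of_le fun A hA => ?_).symm
  filter_upwards [h _ (Filter.inter_mem hA hne), hp] with m hm hprime
  obtain ⟨a, ⟨haA, ha1⟩, ham⟩ := hm
  rcases (PNat.dvd_prime hprime).1 ham with rfl | rfl
  · exact absurd rfl ha1
  · exact haA

theorem not_divT_of_prime_of_ne {p q : βN} (hp : {n : ℕ+ | n.Prime} ∈ p)
    (hq : {n : ℕ+ | n.Prime} ∈ q) (hpq : p ≠ q) :
    ¬ ∃ r : βN, r ≠ (pure 1 : βN) ∧ DivT r p ∧ DivT r q := by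
  rintro ⟨r, hr, hrp, hrq⟩
  exact hpq ((hrp.eq_of_prime hp hr).symm.trans (hrq.eq_of_prime hq hr))

/-- The ultrafilter on `α` generated along the branch `x` of the binary tree, whose nodes are
placed in `α` by `e`. -/
noncomputable def branchUltrafilter {α : Type*} (e : List Bool → α) (x : ℕ → Bool) :
    Ultrafilter α :=
  (Filter.hyperfilter ℕ).map fun n => e ((List.range n).map x)

theorem branchUltrafilter_injective {α : Type*} {e : List Bool → α}
    (he : Function.Injective e) : Function.Injective (branchUltrafilter e) := by
  intro x y hxy
  by_contra hne
  obtain ⟨k, hk⟩ := Function.ne_iff.1 hne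
  have hy : Set.range (fun n => e ((List.range n).map y)) ∈ branchUltrafilter e y :=
    Ultrafilter.mem_map.2 (Filter.univ_mem' Set.mem_range_self)
  rw [← hxy] at hy
  refine Filter.notMem_hyperfilter_of_finite ((Set.finite_Iic k).subset ?_)
    (Ultrafilter.mem_map.1 hy)
  rintro n ⟨m, hm⟩
  have hlist := he hm
  obtain rfl : m = n := by simpa using congrArg List.length hlist
  by_contra hkn
  exact hk (List.map_inj_left.1 hlist k (List.mem_range.2 (not_le.1 hkn))).symm

theorem exists_continuum_many_divT_incompatible :
    ∃ F : Set βN, Cardinal.mk F = Cardinal.continuum ∧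
      ∀ p ∈ F, ∀ q ∈ F, p ≠ q →
        ¬ ∃ r : βN, r ≠ (pure 1 : βN) ∧ DivT r p ∧ DivT r q := by
  let e : List Bool → ℕ+ := fun l => (Infinite.natEmbedding Nat.Primes (Encodable.encode l) : ℕ+)
  have he : Function.Injective e := Nat.Primes.coe_pnat_injective.comp
    ((Infinite.natEmbedding Nat.Primes).injective.comp Encodable.encode_injective)
  have hprime (x : ℕ → Bool) : {n : ℕ+ | n.Prime} ∈ branchUltrafilter e x :=
    Ultrafilter.mem_map.2 (Filter.univ_mem' fun n => (Infinite.natEmbedding Nat.Primes _).2)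
  refine ⟨Set.range (branchUltrafilter e), ?_, ?_⟩
  · rw [Cardinal.mk_range_eq _ (branchUltrafilter_injective he)]
    simp
  · rintro _ ⟨x, rfl⟩ _ ⟨y, rfl⟩ hxy
    exact not_divT_of_prime_of_ne (hprime x) (hprime y) hxy

end Stmt5
end

section
/- If p ∈ βℕ is right cancelable, then p has 2^𝔠 pairwise ∣_L-incomparable ∣_L-successors: there exists a set F ⊆ βℕ of cardinality 2^(2^ℵ₀) such that p ∣_L q for every q ∈ F, and for all distinct q, r ∈ F, ¬(q ∣_L r). -/
attribute [local instance] Ultrafilter.semigroup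

namespace Stmt6

abbrev βN := Ultrafilter ℕ+

/-- `p ∣_L q` iff there is `r` with `q = r * p`. -/
def DivL (p q : βN) : Prop := ∃ r : βN, q = r * p

/-- Finitely many distinct subsets of a type are already distinguished by their traces on some
finite set. -/
theorem exists_finset_injOn_trace {α : Type*} (T : Set (Set α)) (hT : T.Finite) :
    ∃ s : Finset α, Set.InjOn (fun A : Set α => (s : Set α) ∩ A) T := by
  classical
  have key : ∀ P : Set α × Set α, ∃ s : Finset α,
      (s : Set α) ∩ P.1 = (s : Set α) ∩ P.2 → P.1 = P.2 := by
    rintro ⟨A, B⟩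
    by_cases h : A = B
    · exact ⟨∅, fun _ => h⟩
    · obtain ⟨x, hx⟩ : ∃ x, ¬ (x ∈ A ↔ x ∈ B) := by
        by_contra! hc
        exact h (Set.ext hc)
      refine ⟨{x}, fun he => absurd ?_ hx⟩
      have := Set.ext_iff.mp he x
      simpa using this
  choose s hs using key
  refine ⟨(hT.prod hT).toFinset.biUnion s, fun A hA B hB hAB => hs (A, B) ?_⟩
  have hsub : (s (A, B) : Set α) ⊆ ((hT.prod hT).toFinset.biUnion s : Finset α) := by
    exact_mod_cast Finset.subset_biUnion_of_mem s (by simpa using ⟨hA, hB⟩)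
  have h := congrArg (fun C => (s (A, B) : Set α) ∩ C) hAB
  simpa only [← Set.inter_assoc, Set.inter_eq_left.mpr hsub] using h

/-- The independent family of Fichtenholz–Kantorovich and Hausdorff, indexed by `Set ℕ`, on the
countable type `Finset ℕ × Finset (Finset ℕ)`. -/
def independentSet (A : Set ℕ) : Set (Finset ℕ × Finset (Finset ℕ)) :=
  {x | ∃ s ∈ x.2, (s : Set ℕ) = (x.1 : Set ℕ) ∩ A}

theorem exists_forall_mem_independentSet_iff (𝒜 T : Set (Set ℕ)) (hT : T.Finite) :
    ∃ x, ∀ A ∈ T, x ∈ independentSet A ↔ A ∈ 𝒜 := by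
  classical
  obtain ⟨s, hs⟩ := exists_finset_injOn_trace T hT
  refine ⟨(s, (hT.subset (Set.inter_subset_left (t := 𝒜))).toFinset.image
    fun A => s.filter (· ∈ A)), fun A hA => ⟨?_, fun h => ?_⟩⟩
  · rintro ⟨t, ht, hts⟩
    obtain ⟨B, hB, rfl⟩ := Finset.mem_image.mp ht
    have hB' : B ∈ T ∧ B ∈ 𝒜 := by simpa using hB
    have hBA : B = A := hs hB'.1 hA ((Finset.coe_filter _ _).symm.trans hts)
    exact hBA ▸ hB'.2
  · exact ⟨s.filter (· ∈ A), Finset.mem_image_of_mem _ (by simpa using ⟨hA, h⟩), by ext; simp⟩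

theorem exists_ultrafilter_independentSet_mem_iff (𝒜 : Set (Set ℕ)) :
    ∃ U : Ultrafilter (Finset ℕ × Finset (Finset ℕ)),
      ∀ A, independentSet A ∈ U ↔ A ∈ 𝒜 := by
  let S : Set ℕ → Set (Finset ℕ × Finset (Finset ℕ)) :=
    fun A => {x | x ∈ independentSet A ↔ A ∈ 𝒜}
  have hne : (Filter.generate (Set.range S)).NeBot := by
    rw [Filter.generate_neBot_iff]
    intro t ht htf
    obtain ⟨T, -, hT, rfl⟩ := Set.exists_subset_image_finite_and.mp
      ⟨t, (Set.image_univ (f := S)).symm ▸ ht, htf, (rfl : t = t)⟩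
    obtain ⟨x, hx⟩ := exists_forall_mem_independentSet_iff 𝒜 T hT
    exact ⟨x, by rintro _ ⟨A, hA, rfl⟩; exact hx A hA⟩
  refine ⟨Ultrafilter.of (Filter.generate (Set.range S)), fun A => ?_⟩
  have hA : ∀ᶠ x in (Ultrafilter.of (Filter.generate (Set.range S)) : Filter _),
      (x ∈ independentSet A ↔ A ∈ 𝒜) :=
    Ultrafilter.of_le _ (Filter.mem_generate_of_mem ⟨A, rfl⟩)
  exact (Filter.eventually_congr hA).trans Filter.eventually_const

/-- Ultrafilters concentrated on the primes are pairwise incomparable for `DivL`. -/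
theorem eq_of_divL_of_prime {x y : βN} (hx : ∀ᶠ n in (x : Filter ℕ+), n.Prime)
    (hy : ∀ᶠ n in (y : Filter ℕ+), n.Prime) (h : DivL x y) : y = x := by
  obtain ⟨r, rfl⟩ := h
  have hr : ∀ᶠ n in (r : Filter ℕ+), n = 1 := by
    filter_upwards [(Ultrafilter.eventually_mul r x _).mp hy] with n hn
    obtain ⟨m, hnm, hm⟩ := (hn.and hx).exists
    rcases (Nat.prime_mul_iff.mp (by simpa [PNat.Prime] using hnm)) with ⟨-, h1⟩ | ⟨-, h1⟩
    · exact absurd (PNat.coe_eq_one_iff.mp h1) hm.ne_one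
    · exact PNat.coe_eq_one_iff.mp h1
  refine Ultrafilter.coe_inj.mp (Filter.ext' fun P => ?_)
  rw [Ultrafilter.eventually_mul]
  refine (Filter.eventually_congr (hr.mono fun n hn => ?_)).trans Filter.eventually_const
  simp [hn]

theorem right_cancelable_has_many_incomparable_successors
    (p : βN) (hp : ∀ x y : βN, x * p = y * p → x = y) :
    ∃ F : Set βN,
      Cardinal.mk F = (2 : Cardinal) ^ ((2 : Cardinal) ^ Cardinal.aleph0) ∧
      (∀ q ∈ F, DivL p q) ∧
      (∀ q ∈ F, ∀ r ∈ F, q ≠ r → ¬ DivL q r) := by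
  choose U hU using exists_ultrafilter_independentSet_mem_iff
  have hUinj : Function.Injective U := fun 𝒜 ℬ h => Set.ext fun A => by
    rw [← hU 𝒜, ← hU ℬ, h]
  let e : Finset ℕ × Finset (Finset ℕ) → ℕ+ := fun i =>
    ⟨Nat.nth Nat.Prime (Encodable.encode i), (Nat.prime_nth_prime _).pos⟩
  have he : Function.Injective e := fun i j hij => Encodable.encode_injective
    (Nat.nth_injective Nat.infinite_setOfPred_prime (congrArg PNat.val hij))
  let V : Set (Set ℕ) → βN := fun 𝒜 => (U 𝒜).map e
  have hV : ∀ 𝒜, ∀ᶠ n in (V 𝒜 : Filter ℕ+), n.Prime := fun 𝒜 =>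
    Filter.eventually_map.mpr (Filter.Eventually.of_forall fun i => Nat.prime_nth_prime _)
  have hVinj : Function.Injective fun 𝒜 => V 𝒜 * p := fun 𝒜 ℬ h =>
    hUinj (Ultrafilter.coe_inj.mp (Filter.map_injective he
      (congrArg Ultrafilter.toFilter (hp _ _ h))))
  refine ⟨Set.range fun 𝒜 => V 𝒜 * p, ?_, ?_, ?_⟩
  · rw [Cardinal.mk_range_eq _ hVinj]
    simp
  · rintro _ ⟨𝒜, rfl⟩
    exact ⟨V 𝒜, rfl⟩
  · rintro _ ⟨𝒜, rfl⟩ _ ⟨ℬ, rfl⟩ hne ⟨r, hr⟩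
    have h : V ℬ = r * V 𝒜 := hp _ _ (by simpa only [mul_assoc] using hr)
    exact hne (congrArg (· * p) (eq_of_divL_of_prime (hV 𝒜) (hV ℬ) ⟨r, h⟩).symm)

end Stmt6
end

section
/- There is an infinite strictly ∣_L-descending chain of right cancelable elements in βℕ: there exists a sequence (p_n)_{n∈ℕ} of elements of βℕ such that every p_n is right cancelable, p_{n+1} ∣_L p_n for all n, and ¬(p_n ∣_L p_{n+1}) for all n. -/
attribute [local instance] Ultrafilter.semigroup

namespace Stmt7

abbrev βN := Ultrafilter ℕ+

/-- `p ∣_L q` iff there is `r` with `q = r * p`. -/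
def DivL (p q : βN) : Prop := ∃ r : βN, q = r * p

/-- The lacunary sequence of powers of two `2 ^ (2 ^ k - n)`. -/
def lacunary (n k : ℕ) : ℕ+ := 2 ^ (2 ^ k - n)

/-- A nonprincipal ultrafilter concentrated on the sequence `lacunary n`. -/
noncomputable def lacunaryUltrafilter (n : ℕ) : βN :=
  (Filter.hyperfilter ℕ).map (lacunary n)

theorem eventually_hyperfilter_of_forall_ge {P : ℕ → Prop} (N : ℕ) (h : ∀ k, N ≤ k → P k) :
    ∀ᶠ k in (Filter.hyperfilter ℕ : Filter ℕ), P k :=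
  Nat.hyperfilter_le_atTop (Filter.eventually_atTop.2 ⟨N, h⟩)

theorem eventually_mul_lacunaryUltrafilter {x : βN} {n : ℕ} {P : ℕ+ → Prop} :
    (∀ᶠ m in ((x * lacunaryUltrafilter n : βN) : Filter ℕ+), P m) ↔
      ∀ᶠ m in (x : Filter ℕ+), ∀ᶠ k in (Filter.hyperfilter ℕ : Filter ℕ),
        P (m * lacunary n k) :=
  Iff.rfl

theorem two_mul_lacunary_succ {n k : ℕ} (h : n < 2 ^ k) :
    2 * lacunary (n + 1) k = lacunary n k := by
  unfold lacunary
  rw [← pow_succ']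
  congr 1
  omega

theorem two_pow_add_le_of_lt {k l : ℕ} (h : k < l) : 2 ^ k + 2 ^ k ≤ 2 ^ l := by
  have := Nat.pow_le_pow_right (n := 2) (by norm_num) (Nat.succ_le_of_lt h)
  rw [Nat.succ_eq_add_one, pow_succ] at this
  omega

theorem le_of_mul_lacunary_eq {n k l : ℕ} {m m' : ℕ+} (hk : n ≤ 2 ^ k) (hm : (m : ℕ) ≤ k)
    (h : m * lacunary n k = m' * lacunary n l) : l ≤ k := by
  by_contra! hkl
  have hgap := two_pow_add_le_of_lt hkl
  have hcast : (m : ℕ) * 2 ^ (2 ^ k - n) = m' * 2 ^ (2 ^ l - n) := by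
    simpa [lacunary] using congrArg PNat.val h
  rw [show 2 ^ l - n = (2 ^ l - 2 ^ k) + (2 ^ k - n) by omega, pow_add, ← mul_assoc] at hcast
  have hcast := Nat.eq_of_mul_eq_mul_right (by positivity) hcast
  have h₁ : 2 ^ (2 ^ l - 2 ^ k) ≤ (m : ℕ) := hcast ▸ Nat.le_mul_of_pos_left _ m'.pos
  have h₂ : 2 ^ l - 2 ^ k < 2 ^ (2 ^ l - 2 ^ k) := Nat.lt_two_pow_self
  have h₃ : k < 2 ^ k := Nat.lt_two_pow_self
  omega

theorem mul_lacunary_ne_lacunary_succ {n k l : ℕ} {m : ℕ+} (hk : n < 2 ^ k) (hl : n < 2 ^ l)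
    (hm : (m : ℕ) ≤ k) : m * lacunary n k ≠ lacunary (n + 1) l := by
  intro h
  have h' : 2 * m * lacunary n k = 1 * lacunary n l := by
    rw [mul_assoc, h, two_mul_lacunary_succ hl, one_mul]
  have hcast : 2 * (m : ℕ) * 2 ^ (2 ^ k - n) = 2 ^ (2 ^ l - n) := by
    simpa [lacunary] using congrArg PNat.val h'
  have hkl : k < l := by
    by_contra! hlk
    have := Nat.pow_le_pow_right (n := 2) (by norm_num) hlk
    have := Nat.pow_le_pow_right (n := 2) (by norm_num) (Nat.sub_le_sub_right this n)
    have := m.pos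
    have : 0 < 2 ^ (2 ^ k - n) := by positivity
    nlinarith
  have hgap := two_pow_add_le_of_lt hkl
  rw [show 2 ^ l - n = (2 ^ l - 2 ^ k) + (2 ^ k - n) by omega, pow_add] at hcast
  have hcast := Nat.eq_of_mul_eq_mul_right (by positivity) hcast
  rw [show 2 ^ l - 2 ^ k = (2 ^ l - 2 ^ k - 1) + 1 by omega, pow_succ] at hcast
  have h₂ : 2 ^ l - 2 ^ k - 1 < 2 ^ (2 ^ l - 2 ^ k - 1) := Nat.lt_two_pow_self
  have h₃ : k < 2 ^ k := Nat.lt_two_pow_self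
  omega

theorem lacunaryUltrafilter_right_cancel (n : ℕ) {x y : βN}
    (h : x * lacunaryUltrafilter n = y * lacunaryUltrafilter n) : x = y := by
  have key : ∀ (z : βN) (B : Set ℕ+), B ∈ z →
      ∀ᶠ c in ((z * lacunaryUltrafilter n : βN) : Filter ℕ+),
        ∃ m ∈ B, ∃ k, n ≤ 2 ^ k ∧ (m : ℕ) ≤ k ∧ c = m * lacunary n k := by
    intro z B hB
    rw [eventually_mul_lacunaryUltrafilter]
    filter_upwards [hB] with m hm
    refine eventually_hyperfilter_of_forall_ge (n + m) fun k hk => ⟨m, hm, k, ?_, by omega, rfl⟩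
    have : k < 2 ^ k := Nat.lt_two_pow_self
    omega
  refine Ultrafilter.coe_le_coe.1 fun B hB => ?_
  by_contra hx
  have h₁ := key x Bᶜ (Ultrafilter.compl_mem_iff_notMem.2 hx)
  have h₂ := key y B hB
  rw [← h] at h₂
  obtain ⟨c, ⟨m, hm, k, hnk, hmk, hc⟩, m', hm', l, hnl, hml, hc'⟩ := (h₁.and h₂).exists
  have heq := hc.symm.trans hc'
  obtain rfl : k = l :=
    le_antisymm (le_of_mul_lacunary_eq hnl hml heq.symm) (le_of_mul_lacunary_eq hnk hmk heq)
  exact hm (mul_right_cancel heq ▸ hm')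

theorem divL_lacunaryUltrafilter_succ (n : ℕ) :
    DivL (lacunaryUltrafilter (n + 1)) (lacunaryUltrafilter n) := by
  refine ⟨pure 2, Ultrafilter.coe_le_coe.1 fun B hB => ?_⟩
  have hB' : ∀ᶠ k in (Filter.hyperfilter ℕ : Filter ℕ), 2 * lacunary (n + 1) k ∈ B := hB
  have hlarge : ∀ᶠ k in (Filter.hyperfilter ℕ : Filter ℕ), n < 2 ^ k :=
    eventually_hyperfilter_of_forall_ge n fun k hk => hk.trans_lt Nat.lt_two_pow_self
  change ∀ᶠ k in (Filter.hyperfilter ℕ : Filter ℕ), lacunary n k ∈ B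
  filter_upwards [hB', hlarge] with k hk hn
  rwa [← two_mul_lacunary_succ hn]

theorem not_divL_lacunaryUltrafilter_succ (n : ℕ) :
    ¬ DivL (lacunaryUltrafilter n) (lacunaryUltrafilter (n + 1)) := by
  rintro ⟨r, hr⟩
  have hmem : ∀ᶠ c in (lacunaryUltrafilter (n + 1) : Filter ℕ+),
      ∃ l, n < 2 ^ l ∧ c = lacunary (n + 1) l :=
    eventually_hyperfilter_of_forall_ge n fun l hl =>
      ⟨l, hl.trans_lt Nat.lt_two_pow_self, rfl⟩
  rw [hr, eventually_mul_lacunaryUltrafilter] at hmem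
  obtain ⟨m, hm⟩ := hmem.exists
  obtain ⟨k, ⟨l, hl, heq⟩, hk⟩ :=
    (hm.and (eventually_hyperfilter_of_forall_ge (n + m) fun k hk => hk)).exists
  have : k < 2 ^ k := Nat.lt_two_pow_self
  exact mul_lacunary_ne_lacunary_succ (by omega) hl (by omega) heq

theorem exists_infinite_strictly_divL_descending_chain_of_right_cancelable :
    ∃ p : ℕ → βN,
      (∀ n : ℕ, ∀ x y : βN, x * p n = y * p n → x = y) ∧
      (∀ n : ℕ, DivL (p (n + 1)) (p n)) ∧
      (∀ n : ℕ, ¬ DivL (p n) (p (n + 1))) :=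
  ⟨lacunaryUltrafilter, fun n _ _ h => lacunaryUltrafilter_right_cancel n h,
    divL_lacunaryUltrafilter_succ, not_divL_lacunaryUltrafilter_succ⟩

end Stmt7
end

section
/- There is a strictly ∣~-descending chain of length ω+1 in βℕ: there exist a sequence (p_n)_{n∈ℕ} in βℕ and an element q ∈ βℕ such that for every n, p_{n+1} ∣~ p_n and ¬(p_n ∣~ p_{n+1}), and for every n, q ∣~ p_n and ¬(p_n ∣~ q). -/
attribute [local instance] Ultrafilter.semigroup

namespace Stmt8

abbrev βN := Ultrafilter ℕ+

/-- `p ∣_L q` iff there is `r` with `q = r * p`. -/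
def DivL (p q : βN) : Prop := ∃ r : βN, q = r * p

/-- `p ∣~ q`. -/
def DivT (p q : βN) : Prop := ∀ A ∈ p, {m : ℕ+ | ∃ a ∈ A, a ∣ m} ∈ q

theorem divT_map_of_dvd {α : Type*} (u : Ultrafilter α) {f g : α → ℕ+} (h : ∀ k, f k ∣ g k) :
    DivT (u.map f) (u.map g) := by
  intro A hA
  rw [Ultrafilter.mem_map] at hA ⊢
  exact Filter.mem_of_superset hA fun k hk => ⟨f k, hk, h k⟩

theorem divT_pure_one (p : βN) : DivT (pure 1) p := by
  intro A hA
  exact Filter.mem_of_superset Filter.univ_mem fun m _ => ⟨1, hA, one_dvd m⟩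

theorem not_divT_of_multiples {p q : βN} (d : ℕ+) (hp : {m : ℕ+ | d ∣ m} ∈ p)
    (hq : {m : ℕ+ | ¬ d ∣ m} ∈ q) : ¬ DivT p q := by
  intro h
  obtain ⟨m, ⟨a, hda, ham⟩, hm⟩ :=
    Ultrafilter.nonempty_of_mem (Filter.inter_mem (h _ hp) hq)
  exact hm (hda.trans ham)

/-- The `i`-th prime, counted from zero, as a positive natural number. -/
noncomputable def nthPrime (i : ℕ) : ℕ+ := ⟨Nat.nth Nat.Prime i, (Nat.prime_nth_prime i).pos⟩

/-- The product of the `i`-th primes for `n ≤ i < k`. -/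
noncomputable def primeProd (n k : ℕ) : ℕ+ := ∏ i ∈ Finset.Ico n k, nthPrime i

theorem primeProd_succ_dvd (n k : ℕ) : primeProd (n + 1) k ∣ primeProd n k :=
  Finset.prod_dvd_prod_of_subset _ _ _ (Finset.Ico_subset_Ico_left n.le_succ)

theorem nthPrime_dvd_primeProd {n k : ℕ} (h : n < k) : nthPrime n ∣ primeProd n k :=
  Finset.dvd_prod_of_mem _ (Finset.mem_Ico.2 ⟨le_rfl, h⟩)

theorem not_nthPrime_dvd_primeProd_succ (n k : ℕ) : ¬ nthPrime n ∣ primeProd (n + 1) k := by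
  intro h
  have hdvd : Nat.nth Nat.Prime n ∣ ∏ i ∈ Finset.Ico (n + 1) k, Nat.nth Nat.Prime i := by
    have h' := PNat.dvd_iff.1 h
    rwa [primeProd, Finset.PNat.coe_prod] at h'
  obtain ⟨i, hi, hni⟩ := ((Nat.prime_nth_prime n).prime.dvd_finsetProd_iff _).1 hdvd
  have heq := Nat.nth_injective Nat.infinite_setOfPred_prime
    ((Nat.prime_dvd_prime_iff_eq (Nat.prime_nth_prime n) (Nat.prime_nth_prime i)).1 hni)
  have := (Finset.mem_Ico.1 hi).1
  omega

theorem exists_divT_descending_chain_of_length_omega_plus_one :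
    ∃ (p : ℕ → βN) (q : βN),
      (∀ n : ℕ, DivT (p (n + 1)) (p n)) ∧
      (∀ n : ℕ, ¬ DivT (p n) (p (n + 1))) ∧
      (∀ n : ℕ, DivT q (p n)) ∧
      (∀ n : ℕ, ¬ DivT (p n) q) := by
  have mem (n : ℕ) : {m : ℕ+ | nthPrime n ∣ m} ∈
      (Filter.hyperfilter ℕ).map (primeProd n) := by
    rw [Ultrafilter.mem_map]
    refine Nat.hyperfilter_le_atTop ?_
    filter_upwards [Filter.eventually_gt_atTop n] with k hk
    exact nthPrime_dvd_primeProd hk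
  refine ⟨fun n => (Filter.hyperfilter ℕ).map (primeProd n), pure 1,
    fun n => divT_map_of_dvd _ (primeProd_succ_dvd n), fun n => ?_,
    fun n => divT_pure_one _, fun n => ?_⟩
  · refine not_divT_of_multiples (nthPrime n) (mem n) ?_
    rw [Ultrafilter.mem_map]
    exact Filter.univ_mem' (not_nthPrime_dvd_primeProd_succ n)
  · refine not_divT_of_multiples (nthPrime n) (mem n) ?_
    rw [Ultrafilter.mem_pure]
    intro h
    have h1 : Nat.nth Nat.Prime n ∣ 1 := PNat.dvd_iff.1 h
    exact (Nat.prime_nth_prime n).one_lt.ne' (Nat.dvd_one.1 h1)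

end Stmt8
end

section
/- Every ∣_L-ascending chain of length ω has an upper bound in βℕ: if (q_n)_{n∈ℕ} is a sequence in βℕ with q_n ∣_L q_{n+1} for all n, then there exists q ∈ βℕ with q_n ∣_L q for all n. -/
attribute [local instance] Ultrafilter.semigroup

namespace Stmt9

abbrev βN := Ultrafilter ℕ+

/-- `p ∣_L q` iff there is `r` with `q = r * p`. -/
def DivL (p q : βN) : Prop := ∃ r : βN, q = r * p

theorem DivL.trans {p q r : βN} (hpq : DivL p q) (hqr : DivL q r) : DivL p r := by
  obtain ⟨s, rfl⟩ := hpq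
  obtain ⟨t, rfl⟩ := hqr
  exact ⟨t * s, (mul_assoc t s p).symm⟩

/-- The left multiples of `p` form a continuous image of the compact space `βN`. -/
theorem isCompact_setOf_divL (p : βN) : IsCompact {u : βN | DivL p u} := by
  have h : {u : βN | DivL p u} = Set.range (fun r : βN => r * p) := by
    ext u
    exact exists_congr fun _ => eq_comm
  rw [h]
  exact isCompact_range (Ultrafilter.continuous_mul_left p)

theorem divL_ascending_chain_has_upper_bound
    (q : ℕ → βN) (h : ∀ n : ℕ, DivL (q n) (q (n + 1))) :
    ∃ u : βN, ∀ n : ℕ, DivL (q n) u := by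
  obtain ⟨u, hu⟩ := IsCompact.nonempty_iInter_of_sequence_nonempty_isCompact_isClosed
    (fun n => {u : βN | DivL (q n) u}) (fun n _ hu => (h n).trans hu)
    (fun n => ⟨q (n + 1), h n⟩) (isCompact_setOf_divL _)
    (fun n => (isCompact_setOf_divL _).isClosed)
  exact ⟨u, Set.mem_iInter.mp hu⟩

end Stmt9
end

section
/- Every strictly ∣_LN-ascending chain of length ω has a right cancelable upper bound: if (r_n)_{n∈ℕ} is a sequence in βℕ with r_n ∣_LN r_{n+1} and ¬(r_{n+1} ∣_LN r_n) for all n, then there exists a right cancelable q ∈ βℕ with r_n ∣_LN q for all n. -/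
attribute [local instance] Ultrafilter.semigroup

namespace Stmt10

abbrev βN := Ultrafilter ℕ+

/-- `p ∣_L q` iff there is `r` with `q = r * p`. -/
def DivL (p q : βN) : Prop := ∃ r : βN, q = r * p

/-- `p ∣_LN q` iff `p ∣_L n·q` for some `n ∈ ℕ+`. -/
def DivLN (p q : βN) : Prop := ∃ n : ℕ+, DivL p ((pure n : βN) * q)

open Filter Set Topology

section Separation

variable {X : Type*} [TopologicalSpace X]

theorem hasSeparatingCover_of_countable [RegularSpace X] {A B : Set X} (hA : A.Countable)
    (h : Disjoint A (closure B)) : HasSeparatingCover A B := by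
  rcases A.eq_empty_or_nonempty with rfl | hne
  · exact B.hasSeparatingCover_empty_left
  obtain ⟨f, rfl⟩ := hA.exists_eq_range hne
  have key (n : ℕ) : ∃ U : Set X, f n ∈ U ∧ IsOpen U ∧ Disjoint (closure U) B := by
    have hn : (closure B)ᶜ ∈ 𝓝 (f n) :=
      isClosed_closure.isOpen_compl.mem_nhds (disjoint_left.mp h (mem_range_self n))
    obtain ⟨V, hV, hVc, hVB⟩ := exists_mem_nhds_isClosed_subset hn
    refine ⟨interior V, mem_interior_iff_mem_nhds.2 hV, isOpen_interior, ?_⟩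
    exact disjoint_left.2 fun x hx hxB =>
      hVB (closure_minimal interior_subset hVc hx) (subset_closure hxB)
  choose U hU hUo hUd using key
  refine ⟨U, ?_, fun n => ⟨hUo n, hUd n⟩⟩
  rintro _ ⟨n, rfl⟩
  exact mem_iUnion.2 ⟨n, hU n⟩

end Separation

theorem ultrafilter_disjoint_closure_of_isOpen {α : Type*} {U V : Set (Ultrafilter α)}
    (hU : IsOpen U) (hV : IsOpen V) (h : Disjoint U V) : Disjoint (closure U) (closure V) := by
  let C : Set α := {n | pure n ∈ U}
  have hUC : closure U ⊆ {u : Ultrafilter α | C ∈ u} := by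
    refine closure_minimal (fun u hu => ?_) (ultrafilter_isClosed_basic C)
    exact Ultrafilter.tendsto_pure_self u (hU.mem_nhds hu)
  have hVC : closure V ⊆ {u : Ultrafilter α | Cᶜ ∈ u} := by
    refine closure_minimal (fun u hu => ?_) (ultrafilter_isClosed_basic Cᶜ)
    filter_upwards [Ultrafilter.tendsto_pure_self u (hV.mem_nhds hu)] with n hn hnU
    exact disjoint_left.1 h hnU hn
  exact disjoint_left.2 fun u hu hv =>
    Ultrafilter.compl_mem_iff_notMem.1 (hVC hv) (hUC hu)

/-- Countable sets of ultrafilters, neither of which meets the closure of the other, have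
disjoint closures. -/
theorem ultrafilter_disjoint_closure_of_countable {α : Type*} {A B : Set (Ultrafilter α)}
    (hA : A.Countable) (hB : B.Countable) (hAB : Disjoint A (closure B))
    (hBA : Disjoint (closure A) B) : Disjoint (closure A) (closure B) := by
  obtain ⟨U, V, hU, hV, hAU, hBV, hUV⟩ := hasSeparatingCovers_iff_separatedNhds.1
    ⟨hasSeparatingCover_of_countable hA hAB, hasSeparatingCover_of_countable hB hBA.symm⟩
  exact (ultrafilter_disjoint_closure_of_isOpen hU hV hUV).mono
    (closure_mono hAU) (closure_mono hBV)

theorem pure_mul_eq_map (a : ℕ+) (q : βN) : (pure a : βN) * q = q.map (a * ·) :=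
  rfl

theorem pure_mul_comm (a : ℕ+) (q : βN) : (pure a : βN) * q = q * pure a := by
  refine Ultrafilter.coe_injective (Filter.ext' fun p => ?_)
  rw [Ultrafilter.eventually_mul, Ultrafilter.eventually_mul]
  simp [mul_comm]

theorem pure_mul_pure (a b : ℕ+) : (pure a : βN) * pure b = pure (a * b) :=
  rfl

theorem pure_one_mul (q : βN) : (pure 1 : βN) * q = q := by
  rw [pure_mul_eq_map]
  simp

theorem continuous_pure_mul (a : ℕ+) : Continuous fun q : βN => (pure a : βN) * q := by
  simp only [pure_mul_comm]
  exact Ultrafilter.continuous_mul_left _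

theorem isClosed_range_mul (q : βN) : IsClosed (range (· * q : βN → βN)) :=
  (isCompact_range (Ultrafilter.continuous_mul_left q)).isClosed

theorem mul_mem_closure_image {A : Set ℕ+} {x : βN} (hA : A ∈ x) (q : βN) :
    x * q ∈ closure ((fun a => (pure a : βN) * q) '' A) := by
  have hx : Tendsto (fun a => (pure a : βN) * q) x (𝓝 (x * q)) :=
    ((Ultrafilter.continuous_mul_left q).tendsto x).comp (Ultrafilter.tendsto_pure_self x)
  exact mem_closure_of_tendsto hx (mem_of_superset hA fun a ha => mem_image_of_mem _ ha)

theorem closure_image_pure_mul_subset (B : Set ℕ+) (q : βN) :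
    closure ((fun b => (pure b : βN) * q) '' B) ⊆ range (· * q : βN → βN) :=
  closure_minimal (by rintro _ ⟨b, -, rfl⟩; exact ⟨_, rfl⟩) (isClosed_range_mul q)

theorem pure_mul_ne_of_lt {a b : ℕ+} (hab : a < b) (q : βN) :
    (pure a : βN) * q ≠ (pure b : βN) * q := by
  intro h
  have ha : (0 : ℝ) < a := by exact_mod_cast a.pos
  have hb : (0 : ℝ) < b := by exact_mod_cast b.pos
  have hlog : 0 < Real.log b - Real.log a :=
    sub_pos.2 (Real.log_lt_log ha (by exact_mod_cast hab))
  let φ : ℕ+ → ℤ := fun n => ⌊Real.log n / (Real.log b - Real.log a)⌋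
  have hφ (n : ℕ+) : φ (b * n) = φ (a * n) + 1 := by
    have hn : (0 : ℝ) < n := by exact_mod_cast n.pos
    simp only [φ]
    rw [← Int.floor_add_one]
    congr 1
    push_cast
    rw [Real.log_mul hb.ne' hn.ne', Real.log_mul ha.ne' hn.ne']
    field_simp
    ring
  have hiff : {n | Even (φ n)} ∈ (pure a : βN) * q ↔ {n | Even (φ n)} ∈ (pure b : βN) * q := by
    rw [h]
  rw [pure_mul_eq_map, pure_mul_eq_map, Ultrafilter.mem_map, Ultrafilter.mem_map] at hiff
  have hcompl : (b * ·) ⁻¹' {n | Even (φ n)} = ((a * ·) ⁻¹' {n | Even (φ n)})ᶜ := by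
    ext n
    simp [hφ]
  rw [hcompl, Ultrafilter.compl_mem_iff_notMem] at hiff
  exact iff_not_self hiff

theorem pure_mul_ne {a b : ℕ+} (hab : a ≠ b) (q : βN) :
    (pure a : βN) * q ≠ (pure b : βN) * q :=
  hab.lt_or_gt.elim (fun h => pure_mul_ne_of_lt h q) fun h => (pure_mul_ne_of_lt h q).symm

theorem isRightCancelable_of_notMem_closure {q : βN}
    (hq : ∀ (a : ℕ+) (B : Set ℕ+), a ∉ B →
      (pure a : βN) * q ∉ closure ((fun b => (pure b : βN) * q) '' B))
    (x y : βN) (hxy : x * q = y * q) : x = y := by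
  by_contra hne
  obtain ⟨A, hAx, hAy⟩ : ∃ A : Set ℕ+, A ∈ x ∧ A ∉ y := by
    by_contra! hcon
    exact hne (Ultrafilter.coe_le_coe.1 hcon).symm
  have hd := ultrafilter_disjoint_closure_of_countable
    (A := (fun b => (pure b : βN) * q) '' A) (B := (fun b => (pure b : βN) * q) '' Aᶜ)
    (A.to_countable.image _) (Aᶜ.to_countable.image _)
    (disjoint_left.2 (by rintro _ ⟨a, ha, rfl⟩; exact hq a _ (by simpa using ha)))
    (disjoint_right.2 (by rintro _ ⟨a, ha, rfl⟩; exact hq a _ ha))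
  exact disjoint_left.1 hd (mul_mem_closure_image hAx q)
    (hxy ▸ mul_mem_closure_image (Ultrafilter.compl_mem_iff_notMem.2 hAy) q)

theorem range_mul_subset_of_le {u s : ℕ → βN} (hs : ∀ k, u (k + 1) = s k * u k) {i j : ℕ}
    (hij : i ≤ j) : range (· * u j : βN → βN) ⊆ range (· * u i : βN → βN) := by
  induction j, hij using Nat.le_induction with
  | base => exact Subset.rfl
  | succ j _ ih =>
    rintro _ ⟨x, rfl⟩
    refine ih ⟨x * s j, ?_⟩
    simp only [hs, mul_assoc]

theorem pure_mul_mem_range_mul_succ {u s : ℕ → βN} (hs : ∀ k, u (k + 1) = s k * u k) {i j : ℕ}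
    (hij : i < j) (a : ℕ+) : (pure a : βN) * u j ∈ range (· * u (i + 1) : βN → βN) :=
  range_mul_subset_of_le hs hij ⟨_, rfl⟩

theorem pure_mul_notMem_closure_range {u s : ℕ → βN} (hs : ∀ k, u (k + 1) = s k * u k)
    (hu : ∀ (a : ℕ+) k, (pure a : βN) * u k ∉ range (· * u (k + 1) : βN → βN))
    {a b : ℕ+} (hab : a ≠ b) (i : ℕ) :
    (pure a : βN) * u i ∉ closure (range fun j => (pure b : βN) * u j) := by
  intro hi
  have hsub : closure (range fun j => (pure b : βN) * u j) ⊆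
      (fun j => (pure b : βN) * u j) '' Iic i ∪ range (· * u (i + 1) : βN → βN) := by
    refine closure_minimal ?_
      (((finite_Iic i).image _).isClosed.union (isClosed_range_mul (u (i + 1))))
    rintro _ ⟨j, rfl⟩
    rcases le_or_gt j i with hj | hj
    · exact Or.inl ⟨j, hj, rfl⟩
    · exact Or.inr (pure_mul_mem_range_mul_succ hs hj b)
  rcases hsub hi with ⟨j, hj, hji⟩ | hmem
  · rcases (mem_Iic.1 hj).lt_or_eq with hlt | rfl
    · exact hu b j (by
        have := pure_mul_mem_range_mul_succ hs hlt a
        rwa [← hji] at this)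
    · exact pure_mul_ne hab _ hji.symm
  · exact hu a i hmem

/-- A strictly decreasing sequence of left ideals `βN * u k` has a right cancelable element in its
intersection. -/
theorem exists_rightCancelable_mem_range_mul {u s : ℕ → βN} (hs : ∀ k, u (k + 1) = s k * u k)
    (hu : ∀ (a : ℕ+) k, (pure a : βN) * u k ∉ range (· * u (k + 1) : βN → βN)) :
    ∃ q : βN, (∀ x y : βN, x * q = y * q → x = y) ∧ ∀ k, q ∈ range (· * u k : βN → βN) := by
  obtain ⟨q, hq⟩ := exists_clusterPt_of_compactSpace (map u atTop)
  have hqu (k : ℕ) : q ∈ range (· * u k : βN → βN) := by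
    refine (isClosed_range_mul (u k)).closure_subset (hq.mem_closure_of_mem _ ?_)
    refine mem_map.2 (mem_of_superset (Ici_mem_atTop k) fun j hj => ?_)
    exact range_mul_subset_of_le hs hj ⟨pure 1, pure_one_mul _⟩
  have hqc : q ∈ closure (range u) := hq.mem_closure_of_mem _ range_mem_map
  have hac (a : ℕ+) : (pure a : βN) * q ∈ closure (range fun j => (pure a : βN) * u j) := by
    have := image_closure_subset_closure_image (continuous_pure_mul a) (mem_image_of_mem _ hqc)
    rwa [← range_comp] at this
  have hab {a b : ℕ+} (h : a ≠ b) :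
      (pure a : βN) * q ∉ closure (range fun j => (pure b : βN) * u j) := by
    refine disjoint_left.1 (ultrafilter_disjoint_closure_of_countable (countable_range _)
      (countable_range _) ?_ ?_) (hac a)
    · rw [disjoint_left]
      rintro _ ⟨i, rfl⟩
      exact pure_mul_notMem_closure_range hs hu h i
    · rw [disjoint_right]
      rintro _ ⟨i, rfl⟩
      exact pure_mul_notMem_closure_range hs hu h.symm i
  refine ⟨q, isRightCancelable_of_notMem_closure fun a B haB => ?_, hqu⟩
  refine disjoint_left.1 (ultrafilter_disjoint_closure_of_countable (countable_range _)
    (B.to_countable.image _) ?_ ?_) (hac a)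
  · rw [disjoint_left]
    rintro _ ⟨j, rfl⟩ hj
    obtain ⟨x, hx⟩ := closure_image_pure_mul_subset B q hj
    obtain ⟨z, rfl⟩ := hqu (j + 1)
    exact hu a j ⟨x * z, (mul_assoc _ _ _).trans hx⟩
  · rw [disjoint_right]
    rintro _ ⟨b, hb, rfl⟩
    exact hab (ne_of_mem_of_not_mem hb haB)

theorem strictly_divLN_ascending_chain_has_right_cancelable_upper_bound
    (r : ℕ → βN) (h : ∀ n : ℕ, DivLN (r n) (r (n + 1)))
    (h' : ∀ n : ℕ, ¬ DivLN (r (n + 1)) (r n)) :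
    ∃ q : βN, (∀ x y : βN, x * q = y * q → x = y) ∧ ∀ n : ℕ, DivLN (r n) q := by
  choose n s hns using h
  let m (k : ℕ) : ℕ+ := ∏ i ∈ Finset.range k, n i
  have hs (k : ℕ) : (pure (m (k + 1)) : βN) * r (k + 1) = s k * ((pure (m k) : βN) * r k) := by
    simp only [m, Finset.prod_range_succ]
    rw [← pure_mul_pure, mul_assoc, hns, ← mul_assoc, ← mul_assoc, pure_mul_comm]
  have hu (a : ℕ+) (k : ℕ) : (pure a : βN) * ((pure (m k) : βN) * r k) ∉
      range (· * ((pure (m (k + 1)) : βN) * r (k + 1)) : βN → βN) := by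
    rintro ⟨x, hx⟩
    refine h' k ⟨a * m k, x * pure (m (k + 1)), ?_⟩
    rw [← pure_mul_pure, mul_assoc, mul_assoc, ← hx]
  obtain ⟨q, hq, hqu⟩ :=
    exists_rightCancelable_mem_range_mul (u := fun k => (pure (m k) : βN) * r k) hs hu
  refine ⟨q, hq, fun k => ⟨1, ?_⟩⟩
  obtain ⟨z, hz⟩ := hqu k
  exact ⟨z * pure (m k), by rw [pure_one_mul, ← hz, mul_assoc]⟩

end Stmt10
end

section
/- For every q ∈ βℕ, the ∣_LN-divisors of q are linearly preordered by ∣_LN: if p₁ ∣_LN q and p₂ ∣_LN q, then p₁ ∣_LN p₂ or p₂ ∣_LN p₁. -/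
attribute [local instance] Ultrafilter.semigroup

namespace Stmt11

abbrev βN := Ultrafilter ℕ+

/-- `p ∣_L q` iff there is `r` with `q = r * p`. -/
def DivL (p q : βN) : Prop := ∃ r : βN, q = r * p

/-- `p ∣_LN q` iff `p ∣_L n·q` for some `n ∈ ℕ+`. -/
def DivLN (p q : βN) : Prop := ∃ n : ℕ+, DivL p ((pure n : βN) * q)

theorem mem_mul_iff (r p : βN) (A : Set ℕ+) :
    A ∈ r * p ↔ ∀ᶠ n in (r : Filter ℕ+), A ∈ (pure n : βN) * p :=
  Iff.rfl

/-- The left multiples of `p` form a closed set, so a non-multiple of `p` contains a set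
that belongs to no `n·p`. -/
theorem exists_mem_forall_notMem_of_not_divL {p s : βN} (h : ¬ DivL p s) :
    ∃ U ∈ s, ∀ n : ℕ+, U ∉ (pure n : βN) * p := by
  have hclosed : IsClosed (Set.range fun r : βN ↦ r * p) :=
    (isCompact_range (Ultrafilter.continuous_mul_left p)).isClosed
  have hs : s ∈ (Set.range fun r : βN ↦ r * p)ᶜ := by
    rintro ⟨r, hr⟩
    exact h ⟨r, hr.symm⟩
  obtain ⟨_, ⟨U, rfl⟩, hU, hsub⟩ :=
    ultrafilterBasis_is_basis.exists_subset_of_mem_open hs hclosed.isOpen_compl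
  exact ⟨U, hU, fun n hn ↦ hsub hn ⟨pure n, rfl⟩⟩

/-- Two sequences of ultrafilters, each term of which can be separated from the whole other
sequence, can be separated from each other by disjoint sets. -/
theorem exists_disjoint_forall_mem {α ι : Type*} [LinearOrder ι] [LocallyFiniteOrderBot ι]
    {a b : ι → Ultrafilter α}
    (ha : ∀ i, ∃ U ∈ a i, ∀ j, U ∉ b j) (hb : ∀ j, ∃ V ∈ b j, ∀ i, V ∉ a i) :
    ∃ X Y : Set α, Disjoint X Y ∧ (∀ i, X ∈ a i) ∧ ∀ j, Y ∈ b j := by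
  choose U hUa hUb using ha
  choose V hVb hVa using hb
  refine ⟨⋃ i, U i ∩ ⋂ j ∈ Set.Iic i, (V j)ᶜ, ⋃ j, V j ∩ ⋂ i ∈ Set.Iic j, (U i)ᶜ, ?_, ?_, ?_⟩
  · simp only [Set.disjoint_left, Set.mem_iUnion, Set.mem_inter_iff, Set.mem_iInter,
      Set.mem_Iic, Set.mem_compl_iff]
    rintro x ⟨i, hxU, hxV⟩ ⟨j, hxV', hxU'⟩
    rcases le_total i j with hij | hij
    · exact hxU' i hij hxU
    · exact hxV j hij hxV'
  · intro i
    refine Filter.mem_of_superset (Filter.inter_mem (hUa i) ?_)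
      (Set.subset_iUnion (fun i ↦ U i ∩ ⋂ j ∈ Set.Iic i, (V j)ᶜ) i)
    exact (Filter.biInter_mem (Set.finite_Iic i)).2 fun j _ ↦
      Ultrafilter.compl_mem_iff_notMem.2 (hVa j i)
  · intro j
    refine Filter.mem_of_superset (Filter.inter_mem (hVb j) ?_)
      (Set.subset_iUnion (fun j ↦ V j ∩ ⋂ i ∈ Set.Iic j, (U i)ᶜ) j)
    exact (Filter.biInter_mem (Set.finite_Iic j)).2 fun i _ ↦
      Ultrafilter.compl_mem_iff_notMem.2 (hUb i j)

/-- If `p₁` and `p₂` have a common left multiple, then they are comparable for `∣_LN`. -/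
theorem divLN_or_divLN_of_mul_eq_mul {p₁ p₂ r₁ r₂ : βN} (h : r₁ * p₁ = r₂ * p₂) :
    DivLN p₁ p₂ ∨ DivLN p₂ p₁ := by
  by_contra! hcon
  obtain ⟨h₁₂, h₂₁⟩ := hcon
  obtain ⟨X, Y, hXY, hX, hY⟩ := exists_disjoint_forall_mem
    (a := fun n : ℕ+ ↦ (pure n : βN) * p₁) (b := fun n : ℕ+ ↦ (pure n : βN) * p₂)
    (fun n ↦ exists_mem_forall_notMem_of_not_divL fun hn ↦ h₂₁ ⟨n, hn⟩)
    (fun n ↦ exists_mem_forall_notMem_of_not_divL fun hn ↦ h₁₂ ⟨n, hn⟩)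
  have hX' : X ∈ r₁ * p₁ := (mem_mul_iff _ _ _).2 (Filter.Eventually.of_forall hX)
  have hY' : Y ∈ r₁ * p₁ := h ▸ (mem_mul_iff _ _ _).2 (Filter.Eventually.of_forall hY)
  have hinter : X ∩ Y ∈ r₁ * p₁ := Filter.inter_mem hX' hY'
  rw [hXY.inter_eq] at hinter
  exact Ultrafilter.empty_notMem hinter

theorem pure_mul_pure_comm (m n : ℕ+) :
    (pure m : βN) * pure n = (pure n : βN) * pure m := by
  have h (i j : ℕ+) : (pure i : βN) * pure j = pure (i * j) := rfl
  rw [h, h, mul_comm]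

theorem divLN_divisors_linearly_preordered
    (q p₁ p₂ : βN) (h₁ : DivLN p₁ q) (h₂ : DivLN p₂ q) :
    DivLN p₁ p₂ ∨ DivLN p₂ p₁ := by
  obtain ⟨n₁, r₁, h₁⟩ := h₁
  obtain ⟨n₂, r₂, h₂⟩ := h₂
  apply divLN_or_divLN_of_mul_eq_mul (r₁ := pure n₂ * r₁) (r₂ := pure n₁ * r₂)
  rw [mul_assoc, mul_assoc, ← h₁, ← h₂, ← mul_assoc, ← mul_assoc, pure_mul_pure_comm]

end Stmt11
end

section
/- For every p ∈ βℕ, the =_LN-equivalence class of p equals {(pure m)·r : m ∈ ℕ+, r ∈ βℕ, r ∣_L p and ∃ n ∈ ℕ+ with p ∣_L (pure n)·r}. That is, for every q ∈ βℕ: (p ∣_LN q and q ∣_LN p) if and only if there exist m ∈ ℕ+ and r ∈ βℕ with q = (pure m)·r, r ∣_L p, and p ∣_L (pure n)·r for some n ∈ ℕ+. -/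
attribute [local instance] Ultrafilter.semigroup

namespace Stmt12

abbrev βN := Ultrafilter ℕ+

/-- `p ∣_L q` iff there is `r` with `q = r * p`. -/
def DivL (p q : βN) : Prop := ∃ r : βN, q = r * p

/-- `p ∣_LN q` iff `p ∣_L n·q` for some `n ∈ ℕ+`. -/
def DivLN (p q : βN) : Prop := ∃ n : ℕ+, DivL p ((pure n : βN) * q)

theorem pure_mul_eq_map (n : ℕ+) (p : βN) : (pure n : βN) * p = p.map (n * ·) := rfl

theorem pure_mul_pure (m n : ℕ+) : (pure m : βN) * pure n = pure (m * n) := rfl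

/-- Principal ultrafilters are central in `βℕ`. -/
theorem pure_mul_comm (n : ℕ+) (p : βN) : (pure n : βN) * p = p * pure n := by
  refine Ultrafilter.coe_inj.mp (Filter.ext' fun P => ?_)
  simp [Ultrafilter.eventually_mul, mul_comm]

/-- Principal ultrafilters are left cancellable in `βℕ`. -/
theorem pure_mul_left_cancel (n : ℕ+) {p q : βN}
    (h : (pure n : βN) * p = (pure n : βN) * q) : p = q := by
  have key : ∀ u : βN, ∀ s : Set ℕ+,
      s ∈ u ↔ (n * ·) '' s ∈ (pure n : βN) * u := fun u s => by
    rw [pure_mul_eq_map, Ultrafilter.mem_map,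
      Set.preimage_image_eq _ (mul_right_injective n)]
  ext s
  rw [key p, key q, h]

/-- An ultrafilter concentrated on the multiples of `n` is a multiple of `n`. -/
theorem exists_eq_pure_mul (n : ℕ+) (p : βN) (h : ∀ᶠ a in p, n ∣ a) :
    ∃ r : βN, p = (pure n : βN) * r := by
  refine ⟨p.map fun a => PNat.divExact a n, ?_⟩
  refine Ultrafilter.coe_inj.mp (Filter.ext' fun P => ?_)
  rw [Ultrafilter.eventually_mul]
  simp only [Ultrafilter.coe_pure, Filter.eventually_pure, Ultrafilter.coe_map,
    Filter.eventually_map]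
  refine Filter.eventually_congr (h.mono fun a ha => ?_)
  rw [PNat.mul_div_exact ha]

/-- Modulo an ultrafilter, the greatest common divisor with a fixed `k` is constant. -/
theorem exists_eventually_gcd_eq (k : ℕ+) (p : βN) :
    ∃ d : ℕ+, ∀ᶠ a in p, PNat.gcd a k = d := by
  have hfin : (Set.Iic k).Finite := Set.finite_Iic k
  have hmem : (⋃ d ∈ Set.Iic k, {a : ℕ+ | PNat.gcd a k = d}) ∈ p := by
    refine Filter.mem_of_superset Filter.univ_mem fun a _ => ?_
    simpa using PNat.le_of_dvd (PNat.gcd_dvd_right a k)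
  obtain ⟨d, -, hd⟩ := (Ultrafilter.finite_biUnion_mem_iff hfin).mp hmem
  exact ⟨d, hd⟩

/-- If `k` divides a product of ultrafilters, it splits into a divisor of each factor. -/
theorem exists_split_of_pure_mul_eq (k : ℕ+) (p y q : βN)
    (h : (pure k : βN) * p = y * q) :
    ∃ (m : ℕ+) (y' r : βN), q = (pure m : βN) * r ∧ p = y' * r := by
  obtain ⟨d, hd⟩ := exists_eventually_gcd_eq k y
  have hk : ∀ᶠ a in y, ∀ᶠ b in q, k ∣ a * b := by
    rw [← Ultrafilter.eventually_mul]
    change ∀ᶠ c in ((y * q : βN) : Filter ℕ+), k ∣ c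
    rw [← h, pure_mul_eq_map, Ultrafilter.coe_map, Filter.eventually_map]
    exact Filter.Eventually.of_forall fun b => dvd_mul_right k b
  obtain ⟨a, had, hab⟩ := (hd.and hk).exists
  obtain ⟨m, hm⟩ : d ∣ k := had ▸ PNat.gcd_dvd_right a k
  have hq : ∀ᶠ b in q, m ∣ b := hab.mono fun b hb => by
    have h₁ : d * m ∣ d * b := by
      rw [← hm, PNat.dvd_iff, PNat.mul_coe, ← had, PNat.gcd_coe, ← Nat.gcd_mul_right]
      exact Nat.dvd_gcd (by simpa [PNat.dvd_iff] using hb) (dvd_mul_right _ _)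
    rw [PNat.dvd_iff] at h₁ ⊢
    exact Nat.dvd_of_mul_dvd_mul_left d.pos (by simpa using h₁)
  have hy : ∀ᶠ a in y, d ∣ a := hd.mono fun a ha => ha ▸ PNat.gcd_dvd_left a k
  obtain ⟨y', rfl⟩ := exists_eq_pure_mul d y hy
  obtain ⟨r, rfl⟩ := exists_eq_pure_mul m q hq
  refine ⟨m, y', r, rfl, pure_mul_left_cancel k ?_⟩
  rw [h, hm, ← pure_mul_pure, mul_assoc, mul_assoc, ← mul_assoc y', ← pure_mul_comm m y',
    mul_assoc]

theorem eqLN_class_description (p q : βN) :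
    (DivLN p q ∧ DivLN q p) ↔
      ∃ (m : ℕ+) (r : βN), q = (pure m : βN) * r ∧ DivL r p ∧
        ∃ n : ℕ+, DivL p ((pure n : βN) * r) := by
  constructor
  · rintro ⟨⟨n, x, hx⟩, k, y, hy⟩
    obtain ⟨m, y', r, rfl, hp⟩ := exists_split_of_pure_mul_eq k p y q hy
    exact ⟨m, r, rfl, ⟨y', hp⟩, n * m, x, by rw [← pure_mul_pure, mul_assoc, hx]⟩
  · rintro ⟨m, r, rfl, ⟨z, hz⟩, n, x, hx⟩
    refine ⟨⟨n, pure m * x, ?_⟩, m, z, ?_⟩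
    · rw [mul_assoc, ← hx, ← mul_assoc, ← mul_assoc, pure_mul_comm]
    · rw [hz, ← mul_assoc, ← mul_assoc, pure_mul_comm]

end Stmt12
end

section
/- If p ∈ βℕ is right cancelable, then the =_L-class of p is the singleton {p}: for every q ∈ βℕ, if p ∣_L q and q ∣_L p then q = p. -/
attribute [local instance] Ultrafilter.semigroup

namespace Stmt13

abbrev βN := Ultrafilter ℕ+

/-- `p ∣_L q` iff there is `r` with `q = r * p`. -/
def DivL (p q : βN) : Prop := ∃ r : βN, q = r * p

theorem pure_one_mul (p : βN) : (pure 1 : βN) * p = p := by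
  refine Ultrafilter.coe_inj.mp (Filter.ext' fun P => ?_)
  rw [Ultrafilter.eventually_mul]
  change (∀ᶠ m' in (p : Filter ℕ+), P (1 * m')) ↔ _
  simp only [one_mul]

/-- The identity of `βℕ` has only trivial right factors. -/
theorem eq_pure_one_of_mul_eq_pure_one {s r : βN} (h : s * r = pure 1) : r = pure 1 := by
  have hev : ∀ᶠ n : ℕ+ in (s * r : βN), n = 1 := by
    rw [h]
    exact Ultrafilter.mem_pure.2 rfl
  rw [Ultrafilter.eventually_mul] at hev
  obtain ⟨n, hn⟩ := hev.exists
  refine Ultrafilter.eq_of_le ?_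
  rw [Ultrafilter.coe_pure, Filter.le_pure_iff]
  filter_upwards [hn] with m hm
  exact PNat.coe_eq_one_iff.mp (Nat.eq_one_of_mul_eq_one_left (congrArg PNat.val hm))

theorem right_cancelable_eqL_class_singleton
    (p : βN) (hp : ∀ x y : βN, x * p = y * p → x = y) :
    ∀ q : βN, DivL p q → DivL q p → q = p := by
  rintro q ⟨r, rfl⟩ ⟨s, hs⟩
  have hsr : s * r = pure 1 := hp _ _ (by rw [mul_assoc, ← hs, pure_one_mul])
  rw [eq_pure_one_of_mul_eq_pure_one hsr, pure_one_mul]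

end Stmt13
end

section
/- If p ∈ βℕ is left cancelable, then the =_R-class of p is the singleton {p}: for every q ∈ βℕ, if p ∣_R q and q ∣_R p then q = p. -/
attribute [local instance] Ultrafilter.semigroup

namespace Stmt14

abbrev βN := Ultrafilter ℕ+

/-- `p ∣_L q` iff there is `r` with `q = r * p`. -/
def DivL (p q : βN) : Prop := ∃ r : βN, q = r * p

/-- `p ∣_R q` iff there is `r` with `q = p * r`. -/
def DivR (p q : βN) : Prop := ∃ r : βN, q = p * r

theorem mul_pure_one (p : βN) : p * (pure 1 : βN) = p := by
  refine Ultrafilter.coe_inj.mp <| Filter.ext' fun P => ?_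
  rw [Ultrafilter.eventually_mul]
  simp [Ultrafilter.coe_pure]

/-- The only factor of the identity of `βℕ` is the identity itself. -/
theorem eq_pure_one_of_mul_eq_pure_one {r s : βN} (h : r * s = pure 1) : r = pure 1 := by
  have h₁ : ∀ᶠ m in ((r * s : βN) : Filter ℕ+), m = 1 := by
    rw [h, Ultrafilter.coe_pure]
    exact Filter.eventually_pure.mpr rfl
  rw [Ultrafilter.eventually_mul] at h₁
  have h₂ : ∀ᶠ n in (r : Filter ℕ+), n = 1 := by
    filter_upwards [h₁] with n hn
    obtain ⟨m, hm⟩ := hn.exists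
    exact PNat.dvd_one_iff n |>.mp ⟨m, hm.symm⟩
  refine Ultrafilter.coe_le_coe.mp ?_
  rw [Ultrafilter.coe_pure]
  exact Filter.le_pure_iff.mpr h₂

theorem left_cancelable_eqR_class_singleton
    (p : βN) (hp : ∀ x y : βN, p * x = p * y → x = y) :
    ∀ q : βN, DivR p q → DivR q p → q = p := by
  rintro q ⟨r, rfl⟩ ⟨s, hs⟩
  have hrs : r * s = pure 1 := hp _ _ <| by rw [mul_pure_one, ← mul_assoc, ← hs]
  rw [eq_pure_one_of_mul_eq_pure_one hrs, mul_pure_one]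

end Stmt14
end

section
/- For p, q ∈ βℕ the following are equivalent: (i) p ∣~ q; (ii) every member of p that is upward closed under divisibility (A ⊆ ℕ+ with a ∈ A and a ∣ b implying b ∈ A) is a member of q; (iii) every member of q that is downward closed under divisibility (B ⊆ ℕ+ with b ∈ B and a ∣ b implying a ∈ B) is a member of p. -/
attribute [local instance] Ultrafilter.semigroup

namespace Stmt16

abbrev βN := Ultrafilter ℕ+

/-- `p ∣_L q` iff there is `r` with `q = r * p`. -/
def DivL (p q : βN) : Prop := ∃ r : βN, q = r * p

/-- `p ∣~ q`. -/
def DivT (p q : βN) : Prop := ∀ A ∈ p, {m : ℕ+ | ∃ a ∈ A, a ∣ m} ∈ q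

theorem divT_iff_upward_iff_downward (p q : βN) :
    (DivT p q ↔
      ∀ A ∈ p, (∀ a ∈ A, ∀ b : ℕ+, a ∣ b → b ∈ A) → A ∈ q) ∧
    (DivT p q ↔
      ∀ B ∈ q, (∀ b ∈ B, ∀ a : ℕ+, a ∣ b → a ∈ B) → B ∈ p) := by
  have up : DivT p q ↔
      ∀ A ∈ p, (∀ a ∈ A, ∀ b : ℕ+, a ∣ b → b ∈ A) → A ∈ q := by
    refine ⟨fun h A hA hup => ?_, fun h A hA => ?_⟩
    · exact Filter.mem_of_superset (h A hA) fun m ⟨a, ha, ham⟩ => hup a ha m ham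
    · refine h _ (Filter.mem_of_superset hA fun a ha => ⟨a, ha, dvd_rfl⟩) ?_
      rintro m ⟨a, ha, ham⟩ b hmb
      exact ⟨a, ha, ham.trans hmb⟩
  refine ⟨up, up.trans ⟨fun h B hB hdown => ?_, fun h A hA hup => ?_⟩⟩
  · by_contra hBp
    exact Ultrafilter.compl_mem_iff_notMem.mp
      (h Bᶜ (Ultrafilter.compl_mem_iff_notMem.mpr hBp)
        fun a ha b hab hb => ha (hdown b hb a hab)) hB
  · by_contra hAq
    exact Ultrafilter.compl_mem_iff_notMem.mp
      (h Aᶜ (Ultrafilter.compl_mem_iff_notMem.mpr hAq)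
        fun b hb a hab ha => hb (hup a ha b hab)) hA

end Stmt16
end

section
/- The relation ∣_LN is strictly stronger than ∣_L: for any ultrafilter p ∈ βℕ not divisible by 2 (i.e. the set 2ℕ+ of even positive integers is not a member of p) and p nonprincipal, one has (pure 2)·p ∣_LN p but ¬((pure 2)·p ∣_L p). -/
attribute [local instance] Ultrafilter.semigroup

namespace Stmt19

abbrev βN := Ultrafilter ℕ+

/-- `p ∣_L q` iff there is `r` with `q = r * p`. -/
def DivL (p q : βN) : Prop := ∃ r : βN, q = r * p

/-- `p ∣_LN q` iff `p ∣_L n·q` for some `n ∈ ℕ+`. -/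
def DivLN (p q : βN) : Prop := ∃ n : ℕ+, DivL p ((pure n : βN) * q)

theorem divLN_strictly_stronger_than_divL
    (p : βN) (h2 : {n : ℕ+ | (2 : ℕ+) ∣ n} ∉ p) (hfree : ∀ n : ℕ+, p ≠ (pure n : βN)) :
    DivLN ((pure 2 : βN) * p) p ∧ ¬ DivL ((pure 2 : βN) * p) p := by
  refine ⟨⟨2, pure 1, ?_⟩, ?_⟩
  · refine Ultrafilter.coe_inj.mp (Filter.ext' fun P => ?_)
    simp [Ultrafilter.eventually_mul]
  · rintro ⟨r, hr⟩
    apply h2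
    rw [hr]
    change ∀ᶠ n in ↑(r * ((pure 2 : βN) * p)), (2 : ℕ+) ∣ n
    simp only [Ultrafilter.eventually_mul]
    exact Filter.Eventually.of_forall fun m => Filter.eventually_pure.mpr
      (Filter.Eventually.of_forall fun n => (dvd_mul_right 2 n).mul_left m)

end Stmt19
end
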